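/- (Multilinear recursion.) Let x = (x_1,...,x_n) be i.i.d. real random variables with E[x_i] = 0, E[x_i²] = 1 and |x_i| ≤ L almost surely. For each 1 ≤ d ≤ D let {A_i}_{i ∈ T^d_n} be deterministic real matrices of a common dimension, and define F(x) = Σ_{d=1}^{D} Σ_{i ∈ T^d_n} A_i · x_{i_1} ⋯ x_{i_d}. Suppose each homogeneous part F^{=d}(x) is permutation symmetric. Then for every 2 ≤ t < ∞, E ‖F(x) − E F(x)‖_{4t}^{4t} ≤ Σ_{d=1}^{D} D^{4t} (48dt)^{4dt} · Σ_{a+b+c=d, a,b,c ≥ 0} L^{4ct} ‖F^{=d}_{a,b,c}‖_{4t}^{4t}. -/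

import Mathlib

open MeasureTheory ProbabilityTheory Matrix
open scoped BigOperators ENNReal

/-- Entrywise expectation of a random matrix. -/
noncomputable def matIntegral {Ω : Type*} [MeasurableSpace Ω] (μ : Measure Ω)
    {R C : Type*} (M : Ω → Matrix R C ℝ) : Matrix R C ℝ :=
  Matrix.of fun i j => ∫ ω, M ω i j ∂μ

/-- `schattenPow t A = tr ((AᴴA)^t) = ‖A‖_{2t}^{2t}`, the `2t`-th power of the Schatten
`2t`-norm of a real matrix `A`, defined for a real exponent `t` via the eigenvalues of
the Hermitian matrix `AᴴA`. -/
noncomputable def schattenPow {R C : Type*} [Fintype R] [Fintype C] [DecidableEq C]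
    (t : ℝ) (A : Matrix R C ℝ) : ℝ :=
  ∑ i, (Matrix.isHermitian_conjTranspose_mul_self A).eigenvalues i ^ t

/-- The Schatten `2t`-norm of a real matrix: `‖A‖_{2t} = (tr ((AᴴA)^t))^(1/(2t))`. -/
noncomputable def schattenNorm {R C : Type*} [Fintype R] [Fintype C] [DecidableEq C]
    (t : ℝ) (A : Matrix R C ℝ) : ℝ :=
  schattenPow t A ^ (2 * t)⁻¹
/-- Entrywise partial derivative of a matrix-valued function with respect to the
coordinate `v`. -/
noncomputable def pderivAt {ι : Type*} [Fintype ι] [DecidableEq ι] {R C : Type*}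
    (F : (ι → ℝ) → Matrix R C ℝ) (v : ι) : (ι → ℝ) → Matrix R C ℝ :=
  fun x => Matrix.of fun r c => fderiv ℝ (fun y => F y r c) x (Pi.single v 1)

/-- Iterated entrywise partial derivative along a tuple of coordinates. -/
noncomputable def iterPDeriv {ι : Type*} [Fintype ι] [DecidableEq ι] {R C : Type*}
    (F : (ι → ℝ) → Matrix R C ℝ) : {k : ℕ} → (Fin k → ι) → (ι → ℝ) → Matrix R C ℝ
  | 0, _ => F
  | _ + 1, w => pderivAt (iterPDeriv F fun j => w j.castSucc) (w (Fin.last _))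

/-- The partial-derivative block matrix `F_{a,b,c}`: rows carry the `a` vertically stacked
derivative directions, columns the `b` horizontally placed ones, and the `c` block-diagonal
directions appear in both (with the diagonal constraint). -/
noncomputable def derivBlocks {n : ℕ} {R C : Type*}
    (F : (Fin n → ℝ) → Matrix R C ℝ) (a b c : ℕ) :
    (Fin n → ℝ) →
      Matrix ((Fin a → Fin n) × (Fin c → Fin n) × R) ((Fin b → Fin n) × (Fin c → Fin n) × C) ℝ :=
  fun x => Matrix.of fun p q =>
    if p.2.1 = q.2.1 then
      iterPDeriv F (Fin.append (Fin.append p.1 q.1) p.2.1) x p.2.2 q.2.2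
    else 0

/-- The partial-derivative block matrix `F_{a,b}` (no diagonal blocks): rows carry the `a`
vertically stacked derivative directions and columns the `b` horizontally placed ones. -/
noncomputable def derivBlocks2 {ι : Type*} [Fintype ι] [DecidableEq ι] {R C : Type*}
    (F : (ι → ℝ) → Matrix R C ℝ) (a b : ℕ) :
    (ι → ℝ) → Matrix ((Fin a → ι) × R) ((Fin b → ι) × C) ℝ :=
  fun x => Matrix.of fun p q => iterPDeriv F (Fin.append p.1 q.1) x p.2 q.2

namespace MRec

/-- sum of `φ` over roots of the characteristic polynomial -/
noncomputable def spec {m : Type*} [Fintype m] [DecidableEq m] (φ : ℝ → ℝ)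
    (A : Matrix m m ℝ) : ℝ := (A.charpoly.roots.map φ).sum

lemma schattenPow_eq_spec {R C : Type*} [Fintype R] [Fintype C] [DecidableEq C]
    (t : ℝ) (A : Matrix R C ℝ) : schattenPow t A = spec (fun x => x ^ t) (Aᵀ * A) := by
  have h := (Matrix.isHermitian_conjTranspose_mul_self A).roots_charpoly_eq_eigenvalues
  unfold schattenPow spec
  rw [← conjTranspose_eq_transpose_of_trivial A, h, Multiset.map_map]
  rfl

lemma spec_diag {m : Type*} [Fintype m] [DecidableEq m] (φ : ℝ → ℝ)
    (U : Matrix m m ℝ) (a : m → ℝ) (hU : Uᵀ * U = 1) :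
    spec φ (U * diagonal a * Uᵀ) = ∑ i, φ (a i) := by
  unfold spec
  rw [charpoly_mul_comm, ← mul_assoc, hU, one_mul, charpoly_diagonal, Polynomial.roots_prod]
  · simp
  · simp [Finset.prod_ne_zero_iff, Polynomial.X_sub_C_ne_zero]

lemma charpoly_ne_zero' {m : Type*} [Fintype m] [DecidableEq m] (A : Matrix m m ℝ) :
    A.charpoly ≠ 0 := (charpoly_monic A).ne_zero

lemma spec_fromBlocks {m k : Type*} [Fintype m] [DecidableEq m] [Fintype k] [DecidableEq k]
    (φ : ℝ → ℝ) (A : Matrix m m ℝ) (B : Matrix k k ℝ) :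
    spec φ (fromBlocks A 0 0 B) = spec φ A + spec φ B := by
  unfold spec
  rw [charpoly_fromBlocks_zero₁₂, Polynomial.roots_mul
    (mul_ne_zero (charpoly_ne_zero' A) (charpoly_ne_zero' B))]
  simp

lemma spec_mul_comm {m k : Type*} [Fintype m] [DecidableEq m] [Fintype k] [DecidableEq k]
    (φ : ℝ → ℝ) (h0 : φ 0 = 0) (A : Matrix m k ℝ) (B : Matrix k m ℝ) :
    spec φ (A * B) = spec φ (B * A) := by
  have h := congrArg (fun p => (p.roots.map φ).sum) (charpoly_mul_comm' A B)
  rw [Polynomial.roots_mul (mul_ne_zero (pow_ne_zero _ Polynomial.X_ne_zero) (charpoly_ne_zero' _)),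
    Polynomial.roots_mul (mul_ne_zero (pow_ne_zero _ Polynomial.X_ne_zero)
      (charpoly_ne_zero' _))] at h
  simpa [spec, h0, Multiset.nsmul_singleton, Multiset.map_replicate] using h

lemma spec_submatrix {m k : Type*} [Fintype m] [DecidableEq m] [Fintype k] [DecidableEq k]
    (φ : ℝ → ℝ) (A : Matrix m m ℝ) (e : k ≃ m) :
    spec φ (A.submatrix e e) = spec φ A := by
  have := charpoly_reindex e.symm A
  unfold spec
  rw [← this]; rfl

lemma exists_diag {m : Type*} [Fintype m] [DecidableEq m] (A : Matrix m m ℝ) (h : Aᵀ = A) :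
    ∃ (U : Matrix m m ℝ) (a : m → ℝ), Uᵀ * U = 1 ∧ U * Uᵀ = 1 ∧ A = U * diagonal a * Uᵀ := by
  have hA : A.IsHermitian := by
    rw [Matrix.IsHermitian, conjTranspose_eq_transpose_of_trivial]; exact h
  refine ⟨hA.eigenvectorUnitary, hA.eigenvalues, ?_, ?_, ?_⟩
  · have := Unitary.coe_star_mul_self hA.eigenvectorUnitary
    rwa [star_eq_conjTranspose, conjTranspose_eq_transpose_of_trivial] at this
  · have := Unitary.coe_mul_star_self hA.eigenvectorUnitary
    rwa [Unitary.coe_star, star_eq_conjTranspose, conjTranspose_eq_transpose_of_trivial] at this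
  · have := hA.spectral_theorem
    rw [Unitary.conjStarAlgAut_apply, star_eq_conjTranspose,
      conjTranspose_eq_transpose_of_trivial] at this
    exact this

open Classical in
noncomputable def fn {m : Type*} [Fintype m] [DecidableEq m] (φ : ℝ → ℝ) (A : Matrix m m ℝ) :
    Matrix m m ℝ :=
  if h : Aᵀ = A then
    (exists_diag A h).choose * diagonal (fun i => φ ((exists_diag A h).choose_spec.choose i)) *
      ((exists_diag A h).choose)ᵀ
  else 0

section
variable {m : Type*} [Fintype m] [DecidableEq m]

lemma fn_data (A : Matrix m m ℝ) (h : Aᵀ = A) :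
    ∃ (U : Matrix m m ℝ) (a : m → ℝ), Uᵀ * U = 1 ∧ U * Uᵀ = 1 ∧ A = U * diagonal a * Uᵀ ∧
      ∀ φ : ℝ → ℝ, fn φ A = U * diagonal (fun i => φ (a i)) * Uᵀ := by
  obtain ⟨h1, h2, h3⟩ := (exists_diag A h).choose_spec.choose_spec
  refine ⟨_, _, h1, h2, h3, fun φ => ?_⟩
  unfold fn
  rw [dif_pos h]

lemma fn_id (A : Matrix m m ℝ) (h : Aᵀ = A) : fn (fun x => x) A = A := by
  obtain ⟨U, a, _, _, h3, h4⟩ := fn_data A h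
  rw [h4]; exact h3.symm

lemma fn_one (A : Matrix m m ℝ) (h : Aᵀ = A) : fn (fun _ => 1) A = 1 := by
  obtain ⟨U, a, _, h2, h3, h4⟩ := fn_data A h
  rw [h4, diagonal_one, mul_one, h2]

lemma fn_mul (A : Matrix m m ℝ) (h : Aᵀ = A) (φ ψ : ℝ → ℝ) :
    fn φ A * fn ψ A = fn (fun x => φ x * ψ x) A := by
  obtain ⟨U, a, h1, h2, h3, h4⟩ := fn_data A h
  rw [h4, h4, h4]
  calc _ = U * diagonal (fun i => φ (a i)) * (Uᵀ * U) * diagonal (fun i => ψ (a i)) * Uᵀ := by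
        simp only [Matrix.mul_assoc]
    _ = U * (diagonal (fun i => φ (a i)) * diagonal (fun i => ψ (a i))) * Uᵀ := by
        rw [h1, Matrix.mul_one]; simp only [Matrix.mul_assoc]
    _ = _ := by rw [diagonal_mul_diagonal]

lemma fn_symm (A : Matrix m m ℝ) (h : Aᵀ = A) (φ : ℝ → ℝ) : (fn φ A)ᵀ = fn φ A := by
  obtain ⟨U, a, h1, h2, h3, h4⟩ := fn_data A h
  rw [h4]; simp [Matrix.mul_assoc]

lemma trace_fn (A : Matrix m m ℝ) (h : Aᵀ = A) (φ : ℝ → ℝ) : trace (fn φ A) = spec φ A := by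
  obtain ⟨U, a, h1, h2, h3, h4⟩ := fn_data A h
  rw [h4]
  conv_rhs => rw [h3]
  rw [spec_diag φ U a h1, trace_mul_comm, ← Matrix.mul_assoc, h1, Matrix.one_mul, trace_diagonal]

lemma trace_diag_mul (a : m → ℝ) (X Y : Matrix m m ℝ) :
    trace (diagonal a * X * Yᵀ) = ∑ i, ∑ j, a i * X i j * Y i j := by
  simp only [trace, diag_apply]
  refine Finset.sum_congr rfl fun i _ => ?_
  rw [Matrix.mul_apply]
  refine Finset.sum_congr rfl fun j _ => ?_
  rw [diagonal_mul, transpose_apply]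

lemma mixed (A B : Matrix m m ℝ) (hA : Aᵀ = A) (hB : Bᵀ = B) :
    ∃ (a b : m → ℝ) (w : m → m → ℝ), (∀ i j, 0 ≤ w i j) ∧
      ∀ φ ψ : ℝ → ℝ, trace (fn φ A * fn ψ B) = ∑ i, ∑ j, φ (a i) * ψ (b j) * w i j := by
  obtain ⟨U, a, h1, h2, h3, h4⟩ := fn_data A hA
  obtain ⟨V, b, k1, k2, k3, k4⟩ := fn_data B hB
  refine ⟨a, b, fun i j => (Uᵀ * V) i j ^ 2, fun i j => sq_nonneg _, fun φ ψ => ?_⟩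
  rw [h4, k4]
  have : trace (U * diagonal (fun i => φ (a i)) * Uᵀ * (V * diagonal (fun i => ψ (b i)) * Vᵀ))
      = trace (diagonal (fun i => φ (a i)) * (Uᵀ * V * diagonal (fun i => ψ (b i))) *
          (Uᵀ * V)ᵀ) := by
    rw [Matrix.mul_assoc, Matrix.mul_assoc, trace_mul_comm]
    simp [Matrix.mul_assoc]
  rw [this, trace_diag_mul]
  refine Finset.sum_congr rfl fun i _ => Finset.sum_congr rfl fun j _ => ?_
  rw [mul_diagonal]; ring

lemma spec_nonneg (A : Matrix m m ℝ) (h : Aᵀ = A) (φ : ℝ → ℝ) (hφ : ∀ x, 0 ≤ φ x) :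
    0 ≤ spec φ A := by
  obtain ⟨U, a, h1, h2, h3, h4⟩ := fn_data A h
  rw [h3, spec_diag _ _ _ h1]
  exact Finset.sum_nonneg fun i _ => hφ _

/-- scalar inequality -/
lemma rpow_sub_le {r u v : ℝ} (hr : 1 ≤ r) (hu : 0 ≤ u) (huv : u ≤ v) :
    v ^ r - u ^ r ≤ r * (v - u) * v ^ (r - 1) := by
  rcases hu.lt_or_eq with hu0 | hu0
  · have hv : 0 < v := hu0.trans_le huv
    have := one_add_mul_self_le_rpow_one_add (s := u / v - 1)
      (by have : 0 ≤ u / v := by positivity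
          linarith) hr
    rw [add_sub_cancel, Real.div_rpow hu hv.le] at this
    have hvr : 0 < v ^ r := by positivity
    have h2 : v ^ r = v ^ (r - 1) * v := by
      rw [← Real.rpow_add_one hv.ne']; congr 1; ring
    rw [le_div_iff₀ hvr] at this
    have h3 : (1 + r * (u / v - 1)) * v ^ r = v ^ r + r * (u - v) * v ^ (r - 1) := by
      rw [h2]; field_simp
    rw [h3] at this
    linarith
  · subst hu0
    rcases huv.lt_or_eq with hv | hv
    · have h2 : v ^ r = v ^ (r - 1) * v := by
        rw [← Real.rpow_add_one hv.ne']; congr 1; ring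
      rw [Real.zero_rpow (by linarith), h2]
      have : 0 ≤ v ^ (r - 1) * v := by positivity
      nlinarith
    · subst hv; simp

lemma abs_rpow_sub_le {r : ℝ} (hr : 1 ≤ r) (a b : ℝ) :
    |(|a| ^ r - |b| ^ r)| ≤ r * |a - b| * (|a| ^ (r - 1) + |b| ^ (r - 1)) := by
  have key : ∀ a b : ℝ, |a| ≤ |b| →
      |(|a| ^ r - |b| ^ r)| ≤ r * |a - b| * (|a| ^ (r - 1) + |b| ^ (r - 1)) := by
    intro a b hab
    have h1 := rpow_sub_le hr (abs_nonneg a) hab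
    have h2 : |a| ^ r ≤ |b| ^ r := Real.rpow_le_rpow (abs_nonneg _) hab (by linarith)
    rw [abs_sub_comm, abs_of_nonneg (by linarith)]
    refine h1.trans ?_
    have h3 : |b| - |a| ≤ |a - b| := by rw [abs_sub_comm]; exact abs_sub_abs_le_abs_sub b a
    have h4 : 0 ≤ |a| ^ (r - 1) := by positivity
    have h5 : 0 ≤ |b| ^ (r - 1) := by positivity
    have h6 : 0 ≤ |a - b| := abs_nonneg _
    calc r * (|b| - |a|) * |b| ^ (r - 1) ≤ r * |a - b| * |b| ^ (r - 1) := by gcongr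
      _ ≤ _ := by gcongr; linarith
  rcases le_total |a| |b| with h | h
  · exact key a b h
  · have := key b a h
    rw [abs_sub_comm, abs_sub_comm a b, add_comm]; exact this

lemma abs_mul_rpow_sub_le {r : ℝ} (hr : 1 ≤ r) (a b : ℝ) :
    |a * |a| ^ r - b * |b| ^ r| ≤ (r + 1) * |a - b| * (|a| ^ r + |b| ^ r) := by
  have e : ∀ u : ℝ, 0 ≤ u → u ^ r = u * u ^ (r - 1) := by
    intro u hu
    rcases hu.lt_or_eq with h | h
    · rw [mul_comm, ← Real.rpow_add_one h.ne']; congr 1; ring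
    · subst h; rw [Real.zero_rpow (by linarith)]; simp
  have key : ∀ a b : ℝ, |a| ≤ |b| →
      |a * |a| ^ r - b * |b| ^ r| ≤ (r + 1) * |a - b| * (|a| ^ r + |b| ^ r) := by
    intro a b hab
    have h1 := rpow_sub_le hr (abs_nonneg a) hab
    have h2 : |a| ^ r ≤ |b| ^ r := Real.rpow_le_rpow (abs_nonneg _) hab (by linarith)
    have h3 : |b| - |a| ≤ |a - b| := by rw [abs_sub_comm]; exact abs_sub_abs_le_abs_sub b a
    have h4 : 0 ≤ |a| ^ r := by positivity
    have h5 : 0 ≤ |b| ^ (r - 1) := by positivity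
    have h6 : 0 ≤ |a - b| := abs_nonneg _
    have e1 : a * |a| ^ r - b * |b| ^ r = (a - b) * |b| ^ r - a * (|b| ^ r - |a| ^ r) := by ring
    rw [e1]
    have h7 : |a| * (|b| ^ r - |a| ^ r) ≤ |b| * (r * |a - b| * |b| ^ (r - 1)) := by
      apply mul_le_mul hab _ (by linarith) (abs_nonneg _)
      refine h1.trans ?_
      gcongr
    calc |(a - b) * |b| ^ r - a * (|b| ^ r - |a| ^ r)|
        ≤ |(a - b) * |b| ^ r| + |a * (|b| ^ r - |a| ^ r)| := abs_sub _ _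
      _ = |a - b| * |b| ^ r + |a| * (|b| ^ r - |a| ^ r) := by
          rw [abs_mul, abs_mul, abs_of_nonneg (h4.trans h2), abs_of_nonneg (by linarith : 0 ≤ |b| ^ r - |a| ^ r)]
      _ ≤ |a - b| * |b| ^ r + |b| * (r * |a - b| * |b| ^ (r - 1)) := by linarith
      _ = (r + 1) * |a - b| * |b| ^ r := by rw [e |b| (abs_nonneg _)]; ring
      _ ≤ _ := by gcongr; linarith
  rcases le_total |a| |b| with h | h
  · exact key a b h
  · have := key b a h
    rw [abs_sub_comm, abs_sub_comm a b, add_comm (|a| ^ r)]; exact this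

end
end MRec

namespace MRec
section
variable {m : Type*} [Fintype m] [DecidableEq m]

noncomputable def ab (r : ℝ) (x : ℝ) : ℝ := |x| ^ r
noncomputable def sg (r : ℝ) (x : ℝ) : ℝ := x * |x| ^ r

lemma ab_nonneg (r x : ℝ) : 0 ≤ ab r x := by unfold ab; positivity

lemma ab_add_two (r x : ℝ) (hr : 0 < r) : ab (r + 2) x = x * (x * |x| ^ r) := by
  unfold ab
  rw [Real.rpow_add' (abs_nonneg _) (by linarith)]
  rw [Real.rpow_two, sq_abs]; ring

lemma mixed_le (A B : Matrix m m ℝ) (hA : Aᵀ = A) (hB : Bᵀ = B) (φ ψ φ₁ ψ₁ φ₂ ψ₂ : ℝ → ℝ)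
    (h : ∀ a b, φ a * ψ b ≤ φ₁ a * ψ₁ b + φ₂ a * ψ₂ b) :
    trace (fn φ A * fn ψ B) ≤ trace (fn φ₁ A * fn ψ₁ B) + trace (fn φ₂ A * fn ψ₂ B) := by
  obtain ⟨a, b, w, hw, H⟩ := mixed A B hA hB
  rw [H, H, H, ← Finset.sum_add_distrib]
  refine Finset.sum_le_sum fun i _ => ?_
  rw [← Finset.sum_add_distrib]
  refine Finset.sum_le_sum fun j _ => ?_
  rw [← add_mul]
  exact mul_le_mul_of_nonneg_right (h _ _) (hw i j)

lemma fn_smul (A : Matrix m m ℝ) (c : ℝ) (φ : ℝ → ℝ) :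
    fn (fun x => c * φ x) A = c • fn φ A := by
  by_cases h : Aᵀ = A
  · obtain ⟨U, a, _, h2, h3, h4⟩ := fn_data A h
    rw [h4, h4, ← Matrix.smul_mul, ← Matrix.mul_smul, ← diagonal_smul]; rfl
  · unfold fn; simp [h]

lemma mixed_le' (A B : Matrix m m ℝ) (hA : Aᵀ = A) (hB : Bᵀ = B) (φ ψ φ₁ ψ₂ : ℝ → ℝ) (c₁ c₂ : ℝ)
    (h : ∀ a b, φ a * ψ b ≤ c₁ * φ₁ a + c₂ * ψ₂ b) :
    trace (fn φ A * fn ψ B) ≤ c₁ * trace (fn φ₁ A) + c₂ * trace (fn ψ₂ B) := by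
  have := mixed_le A B hA hB φ ψ (fun x => c₁ * φ₁ x) (fun _ => 1) (fun _ => 1)
    (fun x => c₂ * ψ₂ x) (by simpa using h)
  rw [fn_one A hA, fn_one B hB, fn_smul, fn_smul] at this
  simpa using this

lemma fn_id_mul (A : Matrix m m ℝ) (hA : Aᵀ = A) (φ : ℝ → ℝ) :
    A * fn φ A = fn (fun x => x * φ x) A := by
  have := fn_mul A hA (fun x => x) φ
  rwa [fn_id A hA] at this

lemma trace_mul_sg (A : Matrix m m ℝ) (hA : Aᵀ = A) (r : ℝ) (hr : 0 < r) :
    trace (A * fn (sg r) A) = trace (fn (ab (r + 2)) A) := by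
  rw [fn_id_mul A hA]
  congr 2
  funext x; rw [ab_add_two r x hr]; rfl

set_option maxHeartbeats 1000000 in
lemma klein (A B : Matrix m m ℝ) (hA : Aᵀ = A) (hB : Bᵀ = B) (r : ℝ) (hr : 1 ≤ r) :
    trace ((A - B) * (fn (sg r) A - fn (sg r) B)) ≤
      (r + 1) * (trace ((A - B) * (A - B) * fn (ab r) A) +
        trace ((A - B) * (A - B) * fn (ab r) B)) := by
  obtain ⟨a, b, w, hw, H⟩ := mixed A B hA hB
  have e1 : ∀ φ : ℝ → ℝ, trace (fn φ A) = ∑ i, ∑ j, φ (a i) * w i j := by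
    intro φ
    have := H φ (fun _ => 1)
    rw [fn_one B hB] at this
    simpa using this
  have e2 : ∀ φ : ℝ → ℝ, trace (fn φ B) = ∑ i, ∑ j, φ (b j) * w i j := by
    intro φ
    have := H (fun _ => 1) φ
    rw [fn_one A hA] at this
    simpa using this
  have e3 : ∀ φ : ℝ → ℝ, trace (A * fn φ B) = ∑ i, ∑ j, a i * φ (b j) * w i j := by
    intro φ
    have := H (fun x => x) φ
    rwa [fn_id A hA] at this
  have e4 : ∀ φ : ℝ → ℝ, trace (B * fn φ A) = ∑ i, ∑ j, φ (a i) * b j * w i j := by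
    intro φ
    have := H φ (fun x => x)
    rwa [fn_id B hB, trace_mul_comm] at this
  have e5 : ∀ φ : ℝ → ℝ, trace (A * A * fn φ B) = ∑ i, ∑ j, a i * a i * φ (b j) * w i j := by
    intro φ
    have := H (fun x => x * x) φ
    rwa [← fn_mul A hA, fn_id A hA] at this
  have e6 : ∀ φ : ℝ → ℝ, trace (B * B * fn φ A) = ∑ i, ∑ j, φ (a i) * (b j * b j) * w i j := by
    intro φ
    have := H φ (fun x => x * x)
    rwa [← fn_mul B hB, fn_id B hB, trace_mul_comm] at this
  have L : trace ((A - B) * (fn (sg r) A - fn (sg r) B)) =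
      ∑ i, ∑ j, ((a i - b j) * (sg r (a i) - sg r (b j))) * w i j := by
    have : (A - B) * (fn (sg r) A - fn (sg r) B) = fn (fun x => x * sg r x) A - A * fn (sg r) B -
        B * fn (sg r) A + fn (fun x => x * sg r x) B := by
      rw [← fn_id_mul A hA, ← fn_id_mul B hB]; simp only [sub_mul, mul_sub, Matrix.mul_assoc]; abel
    rw [this, trace_add, trace_sub, trace_sub, e1, e2, e3, e4]
    simp only [← Finset.sum_add_distrib, ← Finset.sum_sub_distrib]
    refine Finset.sum_congr rfl fun i _ => Finset.sum_congr rfl fun j _ => ?_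
    ring
  have RA : trace ((A - B) * (A - B) * fn (ab r) A) =
      ∑ i, ∑ j, ((a i - b j) ^ 2 * ab r (a i)) * w i j := by
    have : (A - B) * (A - B) * fn (ab r) A = fn (fun x => x * (x * ab r x)) A -
        A * (B * fn (ab r) A) - B * fn (fun x => x * ab r x) A + B * B * fn (ab r) A := by
      rw [← fn_id_mul A hA (fun x => x * ab r x), ← fn_id_mul A hA (ab r)]; simp only [sub_mul, mul_sub, Matrix.mul_assoc]; abel
    have h2 : trace (A * (B * fn (ab r) A)) = trace (B * fn (fun x => x * ab r x) A) := by
      rw [trace_mul_comm, Matrix.mul_assoc]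
      congr 2
      have := fn_mul A hA (ab r) (fun x => x)
      rw [fn_id A hA] at this
      rw [this]; congr 1; funext x; ring
    rw [this, trace_add, trace_sub, trace_sub, h2, e1, e4, e6]
    simp only [← Finset.sum_add_distrib, ← Finset.sum_sub_distrib]
    refine Finset.sum_congr rfl fun i _ => Finset.sum_congr rfl fun j _ => ?_
    ring
  have RB : trace ((A - B) * (A - B) * fn (ab r) B) =
      ∑ i, ∑ j, ((a i - b j) ^ 2 * ab r (b j)) * w i j := by
    have : (A - B) * (A - B) * fn (ab r) B = A * A * fn (ab r) B -
        A * fn (fun x => x * ab r x) B - B * (A * fn (ab r) B) +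
        fn (fun x => x * (x * ab r x)) B := by
      rw [← fn_id_mul B hB (fun x => x * ab r x), ← fn_id_mul B hB (ab r)]; simp only [sub_mul, mul_sub, Matrix.mul_assoc]; abel
    have h2 : trace (B * (A * fn (ab r) B)) = trace (A * fn (fun x => x * ab r x) B) := by
      rw [trace_mul_comm, Matrix.mul_assoc]
      congr 2
      have := fn_mul B hB (ab r) (fun x => x)
      rw [fn_id B hB] at this
      rw [this]; congr 1; funext x; ring
    rw [this, trace_add, trace_sub, trace_sub, h2, e2, e3, e5]
    simp only [← Finset.sum_add_distrib, ← Finset.sum_sub_distrib]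
    refine Finset.sum_congr rfl fun i _ => Finset.sum_congr rfl fun j _ => ?_
    ring
  rw [L, RA, RB]
  simp only [← Finset.sum_add_distrib, Finset.mul_sum]
  refine Finset.sum_le_sum fun i _ => Finset.sum_le_sum fun j _ => ?_
  rw [← add_mul, ← mul_assoc]
  refine mul_le_mul_of_nonneg_right ?_ (hw i j)
  have h1 := abs_mul_rpow_sub_le hr (a i) (b j)
  calc (a i - b j) * (sg r (a i) - sg r (b j)) ≤ |a i - b j| * |sg r (a i) - sg r (b j)| := by
        rw [← abs_mul]; exact le_abs_self _
    _ ≤ |a i - b j| * ((r + 1) * |a i - b j| * (|a i| ^ r + |b j| ^ r)) := by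
        gcongr; exact h1
    _ = (r + 1) * (|a i - b j| ^ 2 * (|a i| ^ r + |b j| ^ r)) := by ring
    _ = _ := by rw [sq_abs]; unfold ab; ring

lemma young (V F : Matrix m m ℝ) (hV : Vᵀ = V) (hF : Fᵀ = F) (r K : ℝ) (hr : 0 < r) (hK : 0 ≤ K) :
    K * trace (V * fn (ab r) F) ≤ (2 * K) ^ ((r + 2) / 2) / 2 * trace (fn (ab ((r + 2) / 2)) V) +
      1 / 2 * trace (fn (ab (r + 2)) F) := by
  have key := mixed_le' V F hV hF (fun x => K * x) (ab r) (ab ((r + 2) / 2)) (ab (r + 2))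
    ((2 * K) ^ ((r + 2) / 2) / 2) (1 / 2) ?_
  · rw [fn_smul, fn_id V hV] at key
    simpa using key
  intro v f
  have n1 := ab_nonneg r f
  have hkv : K * v ≤ K * |v| := by gcongr; exact le_abs_self v
  have e1 : (2 * K) ^ ((r + 2) / 2) / 2 * ab ((r + 2) / 2) v = (2 * (K * |v|)) ^ ((r + 2) / 2) / 2 := by
    unfold ab
    rw [← mul_assoc, Real.mul_rpow (by positivity) (abs_nonneg _)]; ring
  rw [e1]
  have n2 : 0 ≤ K * |v| := by positivity
  set z := K * |v|
  have e2 : ab (r + 2) f = f ^ 2 * ab r f := by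
    rw [ab_add_two r f hr]; unfold ab; ring
  refine (mul_le_mul_of_nonneg_right hkv n1).trans ?_
  by_cases hc : 2 * z ≤ f ^ 2
  · have : 0 ≤ (2 * z) ^ ((r + 2) / 2) / 2 := by positivity
    rw [e2]
    nlinarith
  · push Not at hc
    have h3 : ab r f ≤ (2 * z) ^ (r / 2) := by
      have : ab r f = (f ^ 2) ^ (r / 2) := by
        unfold ab
        rw [← sq_abs, ← Real.rpow_natCast, ← Real.rpow_mul (abs_nonneg _)]
        congr 1; push_cast; ring
      rw [this]
      exact Real.rpow_le_rpow (sq_nonneg _) hc.le (by linarith)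
    have h4 : (2 * z) ^ ((r + 2) / 2) = (2 * z) * (2 * z) ^ (r / 2) := by
      rw [show (r + 2) / 2 = 1 + r / 2 by ring, Real.rpow_add' (by positivity) (by linarith),
        Real.rpow_one]
    have := ab_nonneg (r + 2) f
    rw [h4]
    nlinarith

lemma tri_aux (A F : Matrix m m ℝ) (hA : Aᵀ = A) (hF : Fᵀ = F) (r D : ℝ) (hr : 0 < r)
    (hD : 0 < D) :
    trace (A * fn (sg r) F) ≤ (2 * D) ^ (r + 1) * trace (fn (ab (r + 2)) A) +
      1 / (2 * D) * trace (fn (ab (r + 2)) F) := by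
  have key := mixed_le' A F hA hF (fun x => x) (sg r) (ab (r + 2)) (ab (r + 2))
    ((2 * D) ^ (r + 1)) (1 / (2 * D)) ?_
  · rwa [fn_id A hA] at key
  intro a f
  have e : ∀ x : ℝ, ab (r + 2) x = |x| * |x| ^ (r + 1) := by
    intro x; unfold ab
    rw [show r + 2 = 1 + (r + 1) by ring, Real.rpow_add' (abs_nonneg _) (by linarith), Real.rpow_one]
  have h0 : a * sg r f ≤ |a| * |f| ^ (r + 1) := by
    refine (le_abs_self _).trans (le_of_eq ?_)
    unfold sg
    rw [abs_mul, abs_mul, abs_of_nonneg (by positivity : 0 ≤ |f| ^ r),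
      Real.rpow_add' (abs_nonneg _) (by linarith), Real.rpow_one]; ring
  refine h0.trans ?_
  rw [e, e]
  have p1 : 0 ≤ |f| ^ (r + 1) := by positivity
  have p2 : 0 ≤ |a| ^ (r + 1) := by positivity
  have p3 : 0 ≤ (2 * D) ^ (r + 1) := by positivity
  by_cases hc : 2 * D * |a| ≤ |f|
  · have : |a| ≤ 1 / (2 * D) * |f| := by
      rw [one_div, ← div_eq_inv_mul, le_div_iff₀ (by positivity)]; linarith
    have h2 : |a| * |f| ^ (r + 1) ≤ 1 / (2 * D) * |f| * |f| ^ (r + 1) := by gcongr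
    have : 0 ≤ (2 * D) ^ (r + 1) * (|a| * |a| ^ (r + 1)) := by positivity
    linarith
  · push Not at hc
    have h3 : |f| ^ (r + 1) ≤ (2 * D) ^ (r + 1) * |a| ^ (r + 1) := by
      rw [← Real.mul_rpow (by positivity) (abs_nonneg _)]
      exact Real.rpow_le_rpow (abs_nonneg _) hc.le (by linarith)
    have : 0 ≤ 1 / (2 * D) * (|f| * |f| ^ (r + 1)) := by positivity
    have h4 : |a| * |f| ^ (r + 1) ≤ |a| * ((2 * D) ^ (r + 1) * |a| ^ (r + 1)) := by gcongr
    linarith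

lemma trace_sum_ab {ι : Type*} (s : Finset ι) (hs : s.Nonempty) (A : ι → Matrix m m ℝ)
    (hA : ∀ i, (A i)ᵀ = A i) (r : ℝ) (hr : 0 < r) :
    trace (fn (ab (r + 2)) (∑ i ∈ s, A i)) ≤
      (2 * s.card : ℝ) ^ (r + 2) * ∑ i ∈ s, trace (fn (ab (r + 2)) (A i)) := by
  have hF : (∑ i ∈ s, A i)ᵀ = ∑ i ∈ s, A i := by
    rw [transpose_sum]; exact Finset.sum_congr rfl fun i _ => hA i
  set F := ∑ i ∈ s, A i with hFdef
  have hD : (0 : ℝ) < s.card := by exact_mod_cast hs.card_pos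
  have h1 : trace (fn (ab (r + 2)) F) = ∑ i ∈ s, trace (A i * fn (sg r) F) := by
    rw [← trace_mul_sg F hF r hr, ← trace_sum, ← Finset.sum_mul]
  have h2 : ∑ i ∈ s, trace (A i * fn (sg r) F) ≤
      ∑ i ∈ s, ((2 * (s.card : ℝ)) ^ (r + 1) * trace (fn (ab (r + 2)) (A i)) +
      1 / (2 * (s.card : ℝ)) * trace (fn (ab (r + 2)) F)) :=
    Finset.sum_le_sum fun i _ => tri_aux (A i) F (hA i) hF r _ hr hD
  rw [Finset.sum_add_distrib, Finset.sum_const, nsmul_eq_mul, ← Finset.mul_sum] at h2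
  have h3 : (s.card : ℝ) * (1 / (2 * (s.card : ℝ)) * trace (fn (ab (r + 2)) F)) =
    trace (fn (ab (r + 2)) F) / 2 := by field_simp
  rw [h3, ← h1] at h2
  have h4 : (2 * s.card : ℝ) ^ (r + 2) = 2 * s.card * (2 * s.card : ℝ) ^ (r + 1) := by
    rw [show r + 2 = 1 + (r + 1) by ring, Real.rpow_add' (by positivity) (by linarith), Real.rpow_one]
  rw [h4]
  have h5 : 0 ≤ ∑ i ∈ s, trace (fn (ab (r + 2)) (A i)) := Finset.sum_nonneg fun i _ => by
    rw [trace_fn _ (hA i)]; exact spec_nonneg _ (hA i) _ (ab_nonneg _)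
  have h6 : (1 : ℝ) ≤ s.card := by exact_mod_cast hs.card_pos
  have h7 : 0 ≤ (2 * s.card : ℝ) ^ (r + 1) * ∑ i ∈ s, trace (fn (ab (r + 2)) (A i)) := by positivity
  nlinarith

end
end MRec

namespace MRec
section
variable {m : Type*} [Fintype m] [DecidableEq m]

lemma compare_aux (r : ℝ) (hr : 2 ≤ r) (s a g : ℝ) :
    |a| ^ (r - 2) * ((r * s) ^ 2 * (g ^ 2 * g ^ 2)) ≤
      1 / 4 * (g ^ 2 * |a| ^ r) + (2 * r * |s|) ^ r / 4 * ab (r + 2) g := by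
  have e2 : ab (r + 2) g = g ^ 2 * |g| ^ r := by
    rw [ab_add_two r g (by linarith)]; ring
  rw [e2]
  have p0 : 0 ≤ |a| ^ (r - 2) := by positivity
  have pr : |a| ^ r = |a| ^ (r - 2) * |a| ^ 2 := by
    rw [← Real.rpow_two, ← Real.rpow_add' (abs_nonneg _) (by linarith)]; congr 1; ring
  have p1 : 0 ≤ (2 * r * |s|) ^ r := by positivity
  have p2 : 0 ≤ |g| ^ r := by positivity
  have p3 : 0 ≤ |a| ^ r := by positivity
  have hg := sq_nonneg g
  by_cases hc : 2 * r * |s| * |g| ≤ |a|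
  · have h1 : (2 * r * |s| * |g|) ^ 2 ≤ |a| ^ 2 := by gcongr
    have h2 : (2 * r * |s| * |g|) ^ 2 = 4 * ((r * s) ^ 2 * g ^ 2) := by
      rw [mul_pow, mul_pow, sq_abs, sq_abs]; ring
    have h3 : (r * s) ^ 2 * g ^ 2 ≤ 1 / 4 * |a| ^ 2 := by linarith
    have h4 : |a| ^ (r - 2) * ((r * s) ^ 2 * (g ^ 2 * g ^ 2)) ≤ 1 / 4 * (g ^ 2 * |a| ^ r) := by
      calc _ = (g ^ 2 * |a| ^ (r - 2)) * ((r * s) ^ 2 * g ^ 2) := by ring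
        _ ≤ (g ^ 2 * |a| ^ (r - 2)) * (1 / 4 * |a| ^ 2) := by gcongr
        _ = _ := by rw [pr]; ring
    have : 0 ≤ (2 * r * |s|) ^ r / 4 * (g ^ 2 * |g| ^ r) := by positivity
    linarith
  · push Not at hc
    have h1 : |a| ^ (r - 2) ≤ (2 * r * |s| * |g|) ^ (r - 2) :=
      Real.rpow_le_rpow (abs_nonneg _) hc.le (by linarith)
    have h2 : (2 * r * |s| * |g|) ^ 2 = 4 * ((r * s) ^ 2 * g ^ 2) := by
      rw [mul_pow, mul_pow, sq_abs, sq_abs]; ring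
    have h3 : (2 * r * |s|) ^ r * |g| ^ r = (2 * r * |s| * |g|) ^ (r - 2) * (2 * r * |s| * |g|) ^ 2 := by
      rw [← Real.mul_rpow (by positivity) (abs_nonneg _), ← Real.rpow_two,
        ← Real.rpow_add' (by positivity) (by linarith)]; congr 1; ring
    have h4 : |a| ^ (r - 2) * ((r * s) ^ 2 * (g ^ 2 * g ^ 2)) ≤
        (2 * r * |s|) ^ r / 4 * (g ^ 2 * |g| ^ r) := by
      calc |a| ^ (r - 2) * ((r * s) ^ 2 * (g ^ 2 * g ^ 2))
          ≤ (2 * r * |s| * |g|) ^ (r - 2) * ((r * s) ^ 2 * (g ^ 2 * g ^ 2)) := by gcongr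
        _ = g ^ 2 / 4 * ((2 * r * |s| * |g|) ^ (r - 2) * (4 * ((r * s) ^ 2 * g ^ 2))) := by ring
        _ = _ := by rw [← h2, ← h3]; ring
    have : 0 ≤ 1 / 4 * (g ^ 2 * |a| ^ r) := by positivity
    linarith

lemma compare_fourth (A G : Matrix m m ℝ) (hA : Aᵀ = A) (hG : Gᵀ = G) (r s : ℝ) (hr : 2 ≤ r) :
    (r * s) ^ 2 * trace (G * G * (G * G) * fn (ab (r - 2)) A) ≤
      1 / 4 * trace (G * G * fn (ab r) A) + (2 * r * |s|) ^ r / 4 * trace (fn (ab (r + 2)) G) := by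
  have key := mixed_le A G hA hG (ab (r - 2)) (fun g => (r * s) ^ 2 * ((g * g) * (g * g)))
    (ab r) (fun g => 1 / 4 * (g * g)) (fun _ => 1) (fun g => (2 * r * |s|) ^ r / 4 * ab (r + 2) g) ?_
  · rw [fn_smul, fn_smul, fn_smul, ← fn_mul G hG (fun g => g * g) (fun g => g * g),
      ← fn_mul G hG, fn_id G hG, fn_one A hA] at key
    simp only [Matrix.mul_smul, trace_smul, Matrix.one_mul, smul_eq_mul] at key
    rw [trace_mul_comm, trace_mul_comm (fn (ab r) A)] at key
    exact key
  intro a g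
  have := compare_aux r hr s a g
  calc _ = |a| ^ (r - 2) * ((r * s) ^ 2 * (g ^ 2 * g ^ 2)) := by unfold ab; ring
    _ ≤ _ := this
    _ = _ := by unfold ab; ring

lemma trace_conj (U V : Matrix m m ℝ) (a : m → ℝ) (hV : V * Vᵀ = 1) (X Y : Matrix m m ℝ)
    (hY : Yᵀ = Y) :
    trace (X * Y * (U * diagonal a * Uᵀ)) =
      ∑ i, ∑ j, a i * (Uᵀ * X * V) i j * (Uᵀ * Y * V) i j := by
  rw [← trace_diag_mul]
  have : diagonal a * (Uᵀ * X * V) * (Uᵀ * Y * V)ᵀ = (diagonal a * Uᵀ) * (X * Y * U) := by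
    simp only [transpose_mul, transpose_transpose, hY]
    calc _ = diagonal a * Uᵀ * X * (V * Vᵀ) * Y * U := by simp only [Matrix.mul_assoc]
      _ = _ := by rw [hV]; simp only [Matrix.mul_assoc, Matrix.mul_one, Matrix.one_mul]
  rw [this, trace_mul_comm (diagonal a * Uᵀ)]
  simp only [Matrix.mul_assoc]

lemma compare_scalar (r s a b W g H : ℝ) (hr : 2 ≤ r) (h : (a - b) * W = s * g) :
    (ab r a - ab r b) * W * H ≤ (1 / 4 * (ab r a * g * g) + (r * s) ^ 2 * (ab (r - 2) a * H * H)) +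
      (1 / 4 * (ab r b * g * g) + (r * s) ^ 2 * (ab (r - 2) b * H * H)) := by
  have key : ∀ x : ℝ, r * |s * g| * |x| ^ (r - 1) * |H| ≤
      1 / 4 * (ab r x * g * g) + (r * s) ^ 2 * (ab (r - 2) x * H * H) := by
    intro x
    have e1 : |x| ^ (r - 1) = |x| ^ (r - 2) * |x| := by
      rw [show r - 1 = (r - 2) + 1 by ring, Real.rpow_add' (abs_nonneg _) (by linarith),
        Real.rpow_one]
    have e2 : ab r x = |x| ^ (r - 2) * |x| ^ 2 := by
      unfold ab
      rw [← Real.rpow_two, ← Real.rpow_add' (abs_nonneg _) (by linarith)]; congr 1; ring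
    rw [e1, e2]
    unfold ab
    have p0 : 0 ≤ |x| ^ (r - 2) := by positivity
    have : r * |s * g| * |x| * |H| ≤ 1 / 4 * (|x| ^ 2 * g * g) + (r * s) ^ 2 * (H * H) := by
      have := sq_nonneg (1 / 2 * (|x| * |g|) - r * |s| * |H|)
      have e3 : |x| ^ 2 * g * g = (|x| * |g|) ^ 2 := by rw [mul_pow, sq_abs g]; ring
      have e4 : (r * s) ^ 2 * (H * H) = (r * |s| * |H|) ^ 2 := by
        rw [mul_pow, mul_pow, mul_pow, sq_abs, sq_abs]; ring
      rw [e3, e4, abs_mul]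
      nlinarith
    nlinarith
  have h1 := abs_rpow_sub_le (by linarith : 1 ≤ r) a b
  calc (ab r a - ab r b) * W * H ≤ |ab r a - ab r b| * |W| * |H| := by
        rw [← abs_mul, ← abs_mul]; exact le_abs_self _
    _ ≤ (r * |a - b| * (|a| ^ (r - 1) + |b| ^ (r - 1))) * |W| * |H| := by
        gcongr; exact h1
    _ = r * |(a - b) * W| * |a| ^ (r - 1) * |H| + r * |(a - b) * W| * |b| ^ (r - 1) * |H| := by
        rw [abs_mul]; ring
    _ ≤ _ := by rw [h]; exact add_le_add (key a) (key b)

set_option maxHeartbeats 1000000 in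
lemma compare (A B G : Matrix m m ℝ) (hA : Aᵀ = A) (hB : Bᵀ = B) (hG : Gᵀ = G) (r s : ℝ)
    (hr : 2 ≤ r) (hs : A - B = s • G) :
    trace (G * G * fn (ab r) A) ≤
      3 * trace (G * G * fn (ab r) B) + (2 * r * |s|) ^ r * trace (fn (ab (r + 2)) G) := by
  have cA := compare_fourth A G hA hG r s hr
  have cB := compare_fourth B G hB hG r s hr
  suffices h : trace (G * G * fn (ab r) A) - trace (G * G * fn (ab r) B) ≤
      (1 / 4 * trace (G * G * fn (ab r) A) +
        (r * s) ^ 2 * trace (G * G * (G * G) * fn (ab (r - 2)) A))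
      + (1 / 4 * trace (G * G * fn (ab r) B) +
        (r * s) ^ 2 * trace (G * G * (G * G) * fn (ab (r - 2)) B)) by
    linarith
  obtain ⟨U, a, u1, u2, u3, u4⟩ := fn_data A hA
  obtain ⟨V, b, v1, v2, v3, v4⟩ := fn_data B hB
  have TA : ∀ X Y : Matrix m m ℝ, ∀ φ : ℝ → ℝ, Yᵀ = Y →
      trace (X * Y * fn φ A) = ∑ i, ∑ j, φ (a i) * (Uᵀ * X * V) i j * (Uᵀ * Y * V) i j := by
    intro X Y φ hY
    rw [u4, trace_conj U V _ v2 X Y hY]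
  have tr : ∀ X : Matrix m m ℝ, Xᵀ = X → ∀ i j, (Vᵀ * X * U) j i = (Uᵀ * X * V) i j := by
    intro X hX i j
    have : (Vᵀ * X * U) = (Uᵀ * X * V)ᵀ := by simp [hX, Matrix.mul_assoc]
    rw [this]; rfl
  have TB : ∀ X Y : Matrix m m ℝ, ∀ φ : ℝ → ℝ, Xᵀ = X → Yᵀ = Y →
      trace (X * Y * fn φ B) = ∑ i, ∑ j, φ (b j) * (Uᵀ * X * V) i j * (Uᵀ * Y * V) i j := by
    intro X Y φ hX hY
    rw [v4, trace_conj V U _ u2 X Y hY, Finset.sum_comm]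
    simp only [tr X hX, tr Y hY]
  have hGG : (G * G)ᵀ = G * G := by simp [hG]
  have a0 := TA 1 (G * G) (ab r) hGG
  have b0 := TB 1 (G * G) (ab r) (by simp) hGG
  rw [Matrix.one_mul] at a0 b0
  have lhs : trace (G * G * fn (ab r) A) - trace (G * G * fn (ab r) B) =
      ∑ i, ∑ j, (ab r (a i) - ab r (b j)) * (Uᵀ * (1 : Matrix m m ℝ) * V) i j *
        (Uᵀ * (G * G) * V) i j := by
    rw [a0, b0]
    simp only [← Finset.sum_sub_distrib]
    refine Finset.sum_congr rfl fun i _ => Finset.sum_congr rfl fun j _ => ?_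
    ring
  rw [lhs, TA G G _ hG, TB G G _ hG hG, TA (G * G) (G * G) _ hGG, TB (G * G) (G * G) _ hGG hGG]
  simp only [← Finset.sum_add_distrib, Finset.mul_sum]
  refine Finset.sum_le_sum fun i _ => Finset.sum_le_sum fun j _ => ?_
  refine compare_scalar r s _ _ _ _ _ hr ?_
  have e1 : Uᵀ * (A - B) * V = diagonal a * (Uᵀ * (1 : Matrix m m ℝ) * V) -
      (Uᵀ * (1 : Matrix m m ℝ) * V) * diagonal b := by
    rw [mul_sub, sub_mul]
    congr 1
    · rw [u3]
      calc _ = (Uᵀ * U) * diagonal a * Uᵀ * V := by simp only [Matrix.mul_assoc]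
        _ = _ := by rw [u1]; simp [Matrix.mul_assoc]
    · rw [v3]
      calc _ = Uᵀ * V * diagonal b * (Vᵀ * V) := by simp only [Matrix.mul_assoc]
        _ = _ := by rw [v1]; simp [Matrix.mul_assoc]
  rw [hs] at e1
  have e2 := congrFun (congrFun e1 i) j
  rw [Matrix.sub_apply, diagonal_mul, mul_diagonal, Matrix.mul_smul, Matrix.smul_mul, Matrix.smul_apply,
    smul_eq_mul] at e2
  rw [e2]; ring

lemma mixed' (A B : Matrix m m ℝ) (hA : Aᵀ = A) (hB : Bᵀ = B) :
    ∃ (a b : m → ℝ) (w : m → m → ℝ), (∀ i j, 0 ≤ w i j) ∧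
      (∀ φ ψ : ℝ → ℝ, trace (fn φ A * fn ψ B) = ∑ i, ∑ j, φ (a i) * ψ (b j) * w i j) ∧
      (∀ φ : ℝ → ℝ, trace (fn φ A) = ∑ i, φ (a i)) ∧
      (∀ φ : ℝ → ℝ, trace (fn φ B) = ∑ i, φ (b i)) := by
  obtain ⟨U, a, h1, h2, h3, h4⟩ := fn_data A hA
  obtain ⟨V, b, k1, k2, k3, k4⟩ := fn_data B hB
  refine ⟨a, b, fun i j => (Uᵀ * V) i j ^ 2, fun i j => sq_nonneg _, fun φ ψ => ?_, ?_, ?_⟩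
  · rw [h4, k4]
    have : trace (U * diagonal (fun i => φ (a i)) * Uᵀ * (V * diagonal (fun i => ψ (b i)) * Vᵀ))
        = trace (diagonal (fun i => φ (a i)) * (Uᵀ * V * diagonal (fun i => ψ (b i))) *
            (Uᵀ * V)ᵀ) := by
      rw [Matrix.mul_assoc, Matrix.mul_assoc, trace_mul_comm]
      simp [Matrix.mul_assoc]
    rw [this, trace_diag_mul]
    refine Finset.sum_congr rfl fun i _ => Finset.sum_congr rfl fun j _ => ?_
    rw [mul_diagonal]; ring
  · intro φ
    rw [trace_fn A hA, h3, spec_diag _ _ _ h1]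
  · intro φ
    rw [trace_fn B hB, k3, spec_diag _ _ _ k1]

lemma fn_lip (A B : Matrix m m ℝ) (hA : Aᵀ = A) (hB : Bᵀ = B) (φ : ℝ → ℝ) (c q : ℝ)
    (hc : 0 ≤ c) (hq : 0 ≤ q)
    (hφ : ∀ a b, |φ a - φ b| ≤ c * |a - b| * (|a| ^ q + |b| ^ q)) :
    trace ((fn φ A - fn φ B) * (fn φ A - fn φ B)) ≤
      (c * ((1 + trace (A * A)) ^ q + (1 + trace (B * B)) ^ q)) ^ 2 *
        trace ((A - B) * (A - B)) := by
  obtain ⟨a, b, w, hw, H, HA, HB⟩ := mixed' A B hA hB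
  have E : ∀ ψ : ℝ → ℝ, trace ((fn ψ A - fn ψ B) * (fn ψ A - fn ψ B)) =
      ∑ i, ∑ j, (ψ (a i) - ψ (b j)) ^ 2 * w i j := by
    intro ψ
    have e1 := H (fun x => ψ x * ψ x) (fun _ => 1)
    have e2 := H (fun _ => 1) (fun x => ψ x * ψ x)
    rw [fn_one B hB, Matrix.mul_one, ← fn_mul A hA] at e1
    rw [fn_one A hA, Matrix.one_mul, ← fn_mul B hB] at e2
    rw [sub_mul, mul_sub, mul_sub, trace_sub, trace_sub, trace_sub, trace_mul_comm (fn ψ B) (fn ψ A),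
      e1, e2, H]
    simp only [← Finset.sum_sub_distrib]
    refine Finset.sum_congr rfl fun i _ => Finset.sum_congr rfl fun j _ => ?_
    ring
  have E1 := E (fun x => x)
  rw [fn_id A hA, fn_id B hB] at E1
  rw [E, E1]
  have bA : ∀ i, |a i| ≤ 1 + trace (A * A) := by
    intro i
    have := HA (fun x => x * x)
    rw [← fn_mul A hA, fn_id A hA] at this
    rw [this]
    have h2 := Finset.single_le_sum (f := fun i => a i * a i)
      (fun i _ => mul_self_nonneg (a i)) (Finset.mem_univ i)
    have h3 : |a i| * |a i| = a i * a i := abs_mul_abs_self _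
    nlinarith [sq_nonneg (|a i| - 1)]
  have bB : ∀ i, |b i| ≤ 1 + trace (B * B) := by
    intro i
    have := HB (fun x => x * x)
    rw [← fn_mul B hB, fn_id B hB] at this
    rw [this]
    have h2 := Finset.single_le_sum (f := fun i => b i * b i)
      (fun i _ => mul_self_nonneg (b i)) (Finset.mem_univ i)
    have h3 : |b i| * |b i| = b i * b i := abs_mul_abs_self _
    nlinarith [sq_nonneg (|b i| - 1)]
  simp only [Finset.mul_sum]
  refine Finset.sum_le_sum fun i _ => Finset.sum_le_sum fun j _ => ?_
  rw [← mul_assoc]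
  refine mul_le_mul_of_nonneg_right ?_ (hw i j)
  rw [← mul_pow, ← sq_abs]
  have h1 := hφ (a i) (b j)
  have h2 : c * |a i - b j| * (|a i| ^ q + |b j| ^ q) ≤
      c * |a i - b j| * ((1 + trace (A * A)) ^ q + (1 + trace (B * B)) ^ q) := by
    have := Real.rpow_le_rpow (abs_nonneg _) (bA i) hq
    have := Real.rpow_le_rpow (abs_nonneg _) (bB j) hq
    gcongr
  have h3 := h1.trans h2
  calc |φ (a i) - φ (b j)| ^ 2 ≤
      (c * |a i - b j| * ((1 + trace (A * A)) ^ q + (1 + trace (B * B)) ^ q)) ^ 2 := by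
        gcongr
    _ = _ := by rw [mul_pow, mul_pow, sq_abs]; ring

lemma sq_le_trace (X : Matrix m m ℝ) (hX : Xᵀ = X) (i j : m) : X i j ^ 2 ≤ trace (X * X) := by
  have : trace (X * X) = ∑ i, ∑ j, X i j ^ 2 := by
    simp only [trace, diag_apply, Matrix.mul_apply]
    refine Finset.sum_congr rfl fun i _ => Finset.sum_congr rfl fun j _ => ?_
    have : X j i = X i j := congrFun (congrFun hX i) j
    rw [this]; ring
  rw [this]
  refine le_trans ?_ (Finset.single_le_sum (f := fun i => ∑ j, X i j ^ 2)
    (fun i _ => Finset.sum_nonneg fun j _ => sq_nonneg _) (Finset.mem_univ i))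
  exact Finset.single_le_sum (f := fun j => X i j ^ 2)
    (fun j _ => sq_nonneg _) (Finset.mem_univ j)

lemma fn_continuous {T : Type*} [TopologicalSpace T] (Y : T → Matrix m m ℝ) (hY : Continuous Y)
    (hs : ∀ z, (Y z)ᵀ = Y z) (φ : ℝ → ℝ) (c q : ℝ) (hc : 0 ≤ c) (hq : 0 ≤ q)
    (hφ : ∀ a b, |φ a - φ b| ≤ c * |a - b| * (|a| ^ q + |b| ^ q)) :
    Continuous fun z => fn φ (Y z) := by
  refine continuous_matrix fun i j => ?_
  rw [continuous_iff_continuousAt]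
  intro z₀
  have hb : ∀ z, |fn φ (Y z) i j - fn φ (Y z₀) i j| ≤ Real.sqrt
      ((c * ((1 + trace (Y z * Y z)) ^ q + (1 + trace (Y z₀ * Y z₀)) ^ q)) ^ 2 *
        trace ((Y z - Y z₀) * (Y z - Y z₀))) := by
    intro z
    apply Real.abs_le_sqrt
    refine le_trans ?_ (fn_lip (Y z) (Y z₀) (hs z) (hs z₀) φ c q hc hq hφ)
    exact sq_le_trace (fn φ (Y z) - fn φ (Y z₀))
      (by rw [transpose_sub, fn_symm _ (hs z), fn_symm _ (hs z₀)]) i j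
  have hcont : Continuous fun z => Real.sqrt
      ((c * ((1 + trace (Y z * Y z)) ^ q + (1 + trace (Y z₀ * Y z₀)) ^ q)) ^ 2 *
        trace ((Y z - Y z₀) * (Y z - Y z₀))) := by
    have h1 : Continuous fun z => (1 + trace (Y z * Y z)) ^ q :=
      Continuous.rpow_const (by fun_prop) (fun _ => Or.inr hq)
    fun_prop
  have h0 := hcont.tendsto z₀
  simp only [sub_self, Matrix.mul_zero, trace_zero, mul_zero, Real.sqrt_zero] at h0
  unfold ContinuousAt
  rw [tendsto_iff_dist_tendsto_zero]
  refine squeeze_zero (fun _ => dist_nonneg) (fun z => ?_) h0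
  rw [Real.dist_eq]; exact hb z

lemma fn_ab_continuous {T : Type*} [TopologicalSpace T] (Y : T → Matrix m m ℝ) (hY : Continuous Y)
    (hs : ∀ z, (Y z)ᵀ = Y z) (r : ℝ) (hr : 1 ≤ r) : Continuous fun z => fn (ab r) (Y z) :=
  fn_continuous Y hY hs _ r (r - 1) (by linarith) (by linarith) (abs_rpow_sub_le hr)

lemma fn_sg_continuous {T : Type*} [TopologicalSpace T] (Y : T → Matrix m m ℝ) (hY : Continuous Y)
    (hs : ∀ z, (Y z)ᵀ = Y z) (r : ℝ) (hr : 1 ≤ r) : Continuous fun z => fn (sg r) (Y z) :=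
  fn_continuous Y hY hs _ (r + 1) r (by linarith) (by linarith) (abs_mul_rpow_sub_le hr)

end
end MRec

namespace MRec
section
variable {Ω : Type*} [MeasurableSpace Ω] {μ : Measure Ω} [IsProbabilityMeasure μ]
    {n : ℕ} {x : Fin n → Ω → ℝ} {L : ℝ}

lemma integrable_cont (hmeas : ∀ i, Measurable (x i)) (hbdd : ∀ i, ∀ᵐ ω ∂μ, |x i ω| ≤ L)
    (Φ : (Fin n → ℝ) → ℝ) (hΦ : Continuous Φ) : Integrable (fun ω => Φ fun i => x i ω) μ := by
  have hK : IsCompact (Set.pi Set.univ fun _ : Fin n => Set.Icc (-L) L) :=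
    isCompact_univ_pi fun _ => isCompact_Icc
  obtain ⟨C, hC⟩ := hK.exists_bound_of_continuousOn hΦ.continuousOn
  have hm : Measurable fun ω => (fun i => x i ω) := measurable_pi_lambda _ hmeas
  refine Integrable.of_bound (hΦ.measurable.comp hm).aestronglyMeasurable C ?_
  filter_upwards [ae_all_iff.2 hbdd] with ω hω
  exact hC _ fun i _ => abs_le.1 (hω i)

lemma integral_indep (hmeas : ∀ i, Measurable (x i)) (hindep : iIndepFun x μ)
    (i : Fin n) (e : ℕ) (Ψ : (Fin n → ℝ) → ℝ) (hΨ : Continuous Ψ) :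
    ∫ ω, (x i ω) ^ e * Ψ (Function.update (fun j => x j ω) i 0) ∂μ =
      (∫ ω, (x i ω) ^ e ∂μ) * ∫ ω, Ψ (Function.update (fun j => x j ω) i 0) ∂μ := by
  have h := hindep.indepFun_finset {i} (Finset.univ.erase i) (by simp) hmeas
  let f : (({i} : Finset (Fin n)) → ℝ) → ℝ := fun v => (v ⟨i, by simp⟩) ^ e
  let g : ({j // j ∈ Finset.univ.erase i} → ℝ) → ℝ := fun v =>
    Ψ (fun j => if hj : j = i then 0 else v ⟨j, by simp [hj]⟩)
  have hf : Measurable f := by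
    exact (measurable_pi_apply _).pow_const e
  have hg : Measurable g := by
    refine hΨ.measurable.comp (measurable_pi_lambda _ fun j => ?_)
    by_cases hj : j = i
    · simp [hj]
    · simp only [hj, dite_false]; exact measurable_pi_apply _
  have h2 := h.comp hf hg
  have e2 : (g ∘ fun a (j : {j // j ∈ Finset.univ.erase i}) => x j a) =
      fun ω => Ψ (Function.update (fun j => x j ω) i 0) := by
    funext ω
    simp only [Function.comp, g]
    congr 1
    funext j
    by_cases hj : j = i
    · subst hj; simp
    · simp [hj]
  have e1 : (f ∘ fun a (j : ({i} : Finset (Fin n))) => x j a) = fun ω => (x i ω) ^ e := by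
    funext ω; simp [f]
  rw [e1, e2] at h2
  have hm : Measurable fun ω => Function.update (fun j => x j ω) i 0 := by
    refine measurable_pi_lambda _ fun j => ?_
    by_cases hj : j = i
    · subst hj; simp
    · simp only [Function.update_of_ne hj]; exact hmeas j
  exact h2.integral_fun_mul_eq_mul_integral ((hmeas i).pow_const e).aestronglyMeasurable
    (hΨ.measurable.comp hm).aestronglyMeasurable

variable {m : Type*} [Fintype m] [DecidableEq m]

lemma upd_cont (i : Fin n) : Continuous fun y : Fin n → ℝ => Function.update y i 0 :=
  continuous_id.update i continuous_const

set_option maxHeartbeats 1000000 in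
lemma step_one (hmeas : ∀ i, Measurable (x i)) (hindep : iIndepFun x μ)
    (hmean : ∀ i, ∫ ω, x i ω ∂μ = 0)
    (hvar : ∀ i, ∫ ω, (x i ω) ^ 2 ∂μ = 1)
    (hbdd : ∀ i, ∀ᵐ ω ∂μ, |x i ω| ≤ L) (hL : 1 ≤ L) (r : ℝ) (hr : 2 ≤ r)
    (F : (Fin n → ℝ) → Matrix m m ℝ) (G : (Fin n → ℝ) → Matrix m m ℝ)
    (hFc : Continuous F) (hGc : Continuous G) (hFs : ∀ y, (F y)ᵀ = F y) (hGs : ∀ y, (G y)ᵀ = G y)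
    (i : Fin n)
    (hd : ∀ y, F y - F (Function.update y i 0) = y i • G y)
    (hG0 : ∀ y, G (Function.update y i 0) = G y) :
    ∫ ω, x i ω * trace (G (fun j => x j ω) * fn (sg r) (F fun j => x j ω)) ∂μ ≤
      (r + 1) * (12 * ∫ ω, trace (G (fun j => x j ω) * G (fun j => x j ω) *
          fn (ab r) (F fun j => x j ω)) ∂μ +
        5 * (2 * r) ^ r * L ^ (r + 2) * ∫ ω, trace (fn (ab (r + 2)) (G fun j => x j ω)) ∂μ) := by
  have hint := fun Φ hΦ => integrable_cont (μ := μ) hmeas hbdd Φ hΦ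
  have c1 := fn_ab_continuous F hFc hFs r (by linarith)
  have c2 := fn_sg_continuous F hFc hFs r (by linarith)
  have c3 := fn_ab_continuous G hGc hGs (r + 2) (by linarith)
  have hu := upd_cont (n := n) i
  have yc : Continuous fun y : Fin n → ℝ => y i := continuous_apply i
  -- abbreviations
  let h : (Fin n → ℝ) → ℝ := fun y => trace (G y * G y * fn (ab r) (F y))
  let M : (Fin n → ℝ) → ℝ := fun y => trace (fn (ab (r + 2)) (G y))
  let Ψ : (Fin n → ℝ) → ℝ := fun y => trace (G y * fn (sg r) (F y))
  have hc : Continuous h := by fun_prop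
  have Mc : Continuous M := by fun_prop
  have Ψc : Continuous Ψ := by fun_prop
  have Mnn : ∀ y, 0 ≤ M y := fun y => by
    simp only [M]; rw [trace_fn _ (hGs y)]; exact spec_nonneg _ (hGs y) _ (ab_nonneg _)
  have L0 : 0 < L := by linarith
  -- pointwise bound
  have pw : ∀ y : Fin n → ℝ, |y i| ≤ L → y i * Ψ y ≤ y i ^ 1 * Ψ (Function.update y i 0) +
      (r + 1) * (4 * (y i ^ 2 * h (Function.update y i 0)) + (2 * r) ^ r * L ^ (r + 2) * M y) := by
    intro y hy
    have k1 := klein (F y) (F (Function.update y i 0)) (hFs _) (hFs _) r (by linarith)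
    have k2 := compare (F y) (F (Function.update y i 0)) (G y) (hFs _) (hFs _) (hGs _) r (y i) hr (hd y)
    rw [hd y] at k1
    simp only [Matrix.smul_mul, Matrix.mul_smul, trace_smul, smul_eq_mul, mul_sub, trace_sub] at k1
    have hh : h (Function.update y i 0) = trace (G y * G y * fn (ab r) (F (Function.update y i 0))) := by
      simp only [h, hG0]
    have hΨ : Ψ (Function.update y i 0) = trace (G y * fn (sg r) (F (Function.update y i 0))) := by
      simp only [Ψ, hG0]
    rw [hh, hΨ]
    have hM : trace (fn (ab (r + 2)) (G y)) = M y := rfl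
    have hΨ' : trace (G y * fn (sg r) (F y)) = Ψ y := rfl
    rw [hM] at k2
    rw [hΨ'] at k1
    have b1 : y i ^ 2 * ((2 * r * |y i|) ^ r * M y) ≤ (2 * r) ^ r * L ^ (r + 2) * M y := by
      have e : L ^ (r + 2) = L ^ 2 * L ^ r := by
        rw [Real.rpow_add L0, Real.rpow_two]; ring
      rw [Real.mul_rpow (by positivity) (abs_nonneg _), e, ← sq_abs]
      have b2 : |y i| ^ r ≤ L ^ r := Real.rpow_le_rpow (abs_nonneg _) hy (by linarith)
      have b3 : |y i| ^ 2 ≤ L ^ 2 := by gcongr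
      have := Mnn y
      calc |y i| ^ 2 * ((2 * r) ^ r * |y i| ^ r * M y) ≤ L ^ 2 * ((2 * r) ^ r * L ^ r * M y) := by
            gcongr
        _ = _ := by ring
    have k3 := mul_le_mul_of_nonneg_left k2 (sq_nonneg (y i))
    have r1 : 0 ≤ r + 1 := by linarith
    set P := trace (G y * G y * fn (ab r) (F y))
    set Q := trace (G y * G y * fn (ab r) (F (Function.update y i 0)))
    have k4 : y i * (y i * P) + y i * (y i * Q) ≤
        4 * (y i ^ 2 * Q) + (2 * r) ^ r * L ^ (r + 2) * M y := by nlinarith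
    have k5 := mul_le_mul_of_nonneg_left k4 r1
    linarith
  have pw2 : ∀ y : Fin n → ℝ, |y i| ≤ L → h (Function.update y i 0) ≤ 3 * h y +
      (2 * r) ^ r * L ^ (r + 2) * M y := by
    intro y hy
    have k2 := compare (F (Function.update y i 0)) (F y) (G y) (hFs _) (hFs _) (hGs _) r (-y i) hr
      (by rw [neg_smul, ← hd y, neg_sub])
    have hh : h (Function.update y i 0) = trace (G y * G y * fn (ab r) (F (Function.update y i 0))) := by
      simp only [h, hG0]
    rw [hh]
    have hM : trace (fn (ab (r + 2)) (G y)) = M y := rfl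
    rw [hM, abs_neg] at k2
    have b1 : (2 * r * |y i|) ^ r * M y ≤ (2 * r) ^ r * L ^ (r + 2) * M y := by
      rw [Real.mul_rpow (by positivity) (abs_nonneg _)]
      have b2 : |y i| ^ r ≤ L ^ r := Real.rpow_le_rpow (abs_nonneg _) hy (by linarith)
      have b3 : L ^ r ≤ L ^ (r + 2) := Real.rpow_le_rpow_of_exponent_le hL (by linarith)
      have := Mnn y
      have := b2.trans b3
      gcongr
    linarith
  have I1 : ∫ ω, x i ω * Ψ (fun j => x j ω) ∂μ ≤
      ∫ ω, (x i ω ^ 1 * Ψ (Function.update (fun j => x j ω) i 0) +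
      (r + 1) * (4 * (x i ω ^ 2 * h (Function.update (fun j => x j ω) i 0)) +
        (2 * r) ^ r * L ^ (r + 2) * M fun j => x j ω)) ∂μ := by
    refine integral_mono_ae (hint (fun y => y i * Ψ y) (by fun_prop))
      (hint (fun y => y i ^ 1 * Ψ (Function.update y i 0) +
      (r + 1) * (4 * (y i ^ 2 * h (Function.update y i 0)) + (2 * r) ^ r * L ^ (r + 2) * M y))
      (by fun_prop)) ?_
    filter_upwards [hbdd i] with ω hω
    exact pw (fun j => x j ω) hω
  have J1 : Integrable (fun ω => x i ω ^ 1 * Ψ (Function.update (fun j => x j ω) i 0)) μ :=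
    hint (fun y => y i ^ 1 * Ψ (Function.update y i 0)) (by fun_prop)
  have J2 : Integrable (fun ω => x i ω ^ 2 * h (Function.update (fun j => x j ω) i 0)) μ :=
    hint (fun y => y i ^ 2 * h (Function.update y i 0)) (by fun_prop)
  have J3 : Integrable (fun ω => M fun j => x j ω) μ := hint _ Mc
  have J5 : Integrable (fun ω => (r + 1) * (4 * (x i ω ^ 2 * h (Function.update (fun j => x j ω) i 0)) +
        (2 * r) ^ r * L ^ (r + 2) * M fun j => x j ω)) μ :=
    hint (fun y => (r + 1) * (4 * (y i ^ 2 * h (Function.update y i 0)) +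
      (2 * r) ^ r * L ^ (r + 2) * M y)) (by fun_prop)
  rw [integral_add J1 J5, integral_const_mul,
    integral_add (J2.const_mul 4) (J3.const_mul _), integral_const_mul, integral_const_mul,
    integral_indep hmeas hindep i 1 Ψ Ψc, integral_indep hmeas hindep i 2 h hc, hvar] at I1
  simp only [pow_one, hmean, zero_mul, zero_add, one_mul] at I1
  have I2 : ∫ ω, h (Function.update (fun j => x j ω) i 0) ∂μ ≤
      ∫ ω, (3 * h (fun j => x j ω) + (2 * r) ^ r * L ^ (r + 2) * M fun j => x j ω) ∂μ := by
    refine integral_mono_ae (hint (fun y => h (Function.update y i 0)) (by fun_prop))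
      (hint (fun y => 3 * h y + (2 * r) ^ r * L ^ (r + 2) * M y) (by fun_prop)) ?_
    filter_upwards [hbdd i] with ω hω
    exact pw2 (fun j => x j ω) hω
  have J4 : Integrable (fun ω => h fun j => x j ω) μ := hint _ hc
  rw [integral_add (J4.const_mul _) (J3.const_mul _), integral_const_mul, integral_const_mul] at I2
  refine I1.trans ?_
  refine mul_le_mul_of_nonneg_left ?_ (by linarith)
  change _ ≤ 12 * (∫ ω, h (fun j => x j ω) ∂μ) + 5 * (2 * r) ^ r * L ^ (r + 2) * ∫ ω, M (fun j => x j ω) ∂μ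
  linarith

set_option maxHeartbeats 1000000 in
lemma step_herm (hmeas : ∀ i, Measurable (x i)) (hindep : iIndepFun x μ)
    (hmean : ∀ i, ∫ ω, x i ω ∂μ = 0)
    (hvar : ∀ i, ∫ ω, (x i ω) ^ 2 ∂μ = 1)
    (hbdd : ∀ i, ∀ᵐ ω ∂μ, |x i ω| ≤ L) (hL : 1 ≤ L) (r : ℝ) (hr : 6 ≤ r)
    (F : (Fin n → ℝ) → Matrix m m ℝ) (G : Fin n → (Fin n → ℝ) → Matrix m m ℝ)
    (hFc : Continuous F) (hGc : ∀ i, Continuous (G i)) (hFs : ∀ y, (F y)ᵀ = F y)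
    (hGs : ∀ i y, (G i y)ᵀ = G i y) (k : ℕ)
    (hE : ∀ y, ((k : ℝ) + 1) • F y = ∑ i, y i • G i y)
    (hd : ∀ i y, F y - F (Function.update y i 0) = y i • G i y)
    (hG0 : ∀ i y, G i (Function.update y i 0) = G i y) :
    ∫ ω, trace (fn (ab (r + 2)) (F fun j => x j ω)) ∂μ ≤
      (2 * (r + 2)) ^ (r + 2) *
        (∫ ω, trace (fn (ab ((r + 2) / 2)) (∑ i, G i (fun j => x j ω) * G i (fun j => x j ω))) ∂μ +
        L ^ (r + 2) * ∑ i, ∫ ω, trace (fn (ab (r + 2)) (G i fun j => x j ω)) ∂μ) := by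
  have hint := fun Φ hΦ => integrable_cont (μ := μ) hmeas hbdd Φ hΦ
  let V : (Fin n → ℝ) → Matrix m m ℝ := fun y => ∑ i, G i y * G i y
  have Vc : Continuous V := by
    refine continuous_finsetSum _ fun i _ => ?_
    have := hGc i
    fun_prop
  have Vs : ∀ y, (V y)ᵀ = V y := by
    intro y; simp only [V, transpose_sum, transpose_mul, hGs]
  have c1 := fn_ab_continuous F hFc hFs r (by linarith)
  have c1' := fn_ab_continuous F hFc hFs (r + 2) (by linarith)
  have c2 := fn_sg_continuous F hFc hFs r (by linarith)
  have c4 := fn_ab_continuous V Vc Vs ((r + 2) / 2) (by linarith)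
  set T := ∫ ω, trace (fn (ab (r + 2)) (F fun j => x j ω)) ∂μ with hT
  set TV := ∫ ω, trace (fn (ab ((r + 2) / 2)) (V fun j => x j ω)) ∂μ with hTV
  set S := ∑ i, ∫ ω, trace (fn (ab (r + 2)) (G i fun j => x j ω)) ∂μ with hS
  have nnF : ∀ y, 0 ≤ trace (fn (ab (r + 2)) (F y)) := fun y => by
    rw [trace_fn _ (hFs y)]; exact spec_nonneg _ (hFs y) _ (ab_nonneg _)
  have T0 : 0 ≤ T := integral_nonneg fun ω => nnF _
  have TV0 : 0 ≤ TV := integral_nonneg fun ω => by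
    rw [Pi.zero_apply, trace_fn _ (Vs _)]; exact spec_nonneg _ (Vs _) _ (ab_nonneg _)
  have S0 : 0 ≤ S := Finset.sum_nonneg fun i _ => integral_nonneg fun ω => by
    rw [Pi.zero_apply, trace_fn _ (hGs _ _)]; exact spec_nonneg _ (hGs _ _) _ (ab_nonneg _)
  have h1 : ((k : ℝ) + 1) * T =
      ∑ i, ∫ ω, x i ω * trace (G i (fun j => x j ω) * fn (sg r) (F fun j => x j ω)) ∂μ := by
    rw [← integral_finsetSum, hT, ← integral_const_mul]
    · congr 1
      funext ω
      rw [← trace_mul_sg _ (hFs _) r (by linarith), ← smul_eq_mul, ← trace_smul, ← Matrix.smul_mul, hE,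
        Finset.sum_mul, trace_sum]
      refine Finset.sum_congr rfl fun i _ => ?_
      rw [Matrix.smul_mul, trace_smul, smul_eq_mul]
    · intro i _
      have := hGc i
      exact hint (fun y => y i * trace (G i y * fn (sg r) (F y))) (by fun_prop)
  have h2 : ((k : ℝ) + 1) * T ≤ (r + 1) * (12 * ∫ ω, trace (V (fun j => x j ω) *
          fn (ab r) (F fun j => x j ω)) ∂μ + 5 * (2 * r) ^ r * L ^ (r + 2) * S) := by
    rw [h1]
    refine (Finset.sum_le_sum fun i _ => step_one hmeas hindep hmean hvar hbdd hL r (by linarith) F (G i)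
      hFc (hGc i) hFs (hGs i) i (hd i) (hG0 i)).trans (le_of_eq ?_)
    rw [← Finset.mul_sum, Finset.sum_add_distrib, ← Finset.mul_sum, ← Finset.mul_sum,
      ← integral_finsetSum]
    · congr 3
      congr 1
      funext ω
      simp only [V, Finset.sum_mul, trace_sum]
    · intro i _
      have := hGc i
      exact hint (fun y => trace (G i y * G i y * fn (ab r) (F y))) (by fun_prop)
  have h3 : (12 * (r + 1)) * ∫ ω, trace (V (fun j => x j ω) * fn (ab r) (F fun j => x j ω)) ∂μ ≤
      (2 * (12 * (r + 1))) ^ ((r + 2) / 2) / 2 * TV + 1 / 2 * T := by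
    rw [hTV, hT, ← integral_const_mul, ← integral_const_mul, ← integral_const_mul, ← integral_add]
    · refine integral_mono (hint (fun y => 12 * (r + 1) * trace (V y * fn (ab r) (F y)))
        (by fun_prop)) (hint (fun y => (2 * (12 * (r + 1))) ^ ((r + 2) / 2) / 2 *
          trace (fn (ab ((r + 2) / 2)) (V y)) + 1 / 2 * trace (fn (ab (r + 2)) (F y)))
          (by fun_prop)) fun ω => ?_
      exact young _ _ (Vs _) (hFs _) r _ (by linarith) (by linarith)
    · exact hint (fun y => (2 * (12 * (r + 1))) ^ ((r + 2) / 2) / 2 *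
          trace (fn (ab ((r + 2) / 2)) (V y))) (by fun_prop)
    · exact hint (fun y => 1 / 2 * trace (fn (ab (r + 2)) (F y))) (by fun_prop)
  have kT : T ≤ ((k : ℝ) + 1) * T := by
    have : (0 : ℝ) ≤ k := Nat.cast_nonneg k
    nlinarith
  have h4 : T ≤ (2 * (12 * (r + 1))) ^ ((r + 2) / 2) * TV +
      10 * (r + 1) * (2 * r) ^ r * (L ^ (r + 2) * S) := by
    nlinarith
  have C1 : (2 * (12 * (r + 1))) ^ ((r + 2) / 2) ≤ (2 * (r + 2)) ^ (r + 2) := by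
    have : (2 * (r + 2)) ^ (r + 2) = ((2 * (r + 2)) ^ 2) ^ ((r + 2) / 2) := by
      rw [← Real.rpow_natCast, ← Real.rpow_mul (by linarith)]
      congr 1; push_cast; ring
    rw [this]
    apply Real.rpow_le_rpow (by linarith) (by nlinarith) (by linarith)
  have C2 : 10 * (r + 1) * (2 * r) ^ r ≤ (2 * (r + 2)) ^ (r + 2) := by
    rw [Real.rpow_add (by linarith) r 2, Real.rpow_two]
    have a1 : (2 * r) ^ r ≤ (2 * (r + 2)) ^ r := Real.rpow_le_rpow (by linarith) (by linarith) (by linarith)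
    have a2 : 10 * (r + 1) ≤ (2 * (r + 2)) ^ 2 := by nlinarith
    rw [mul_comm]
    exact mul_le_mul a1 a2 (by linarith) (by positivity)
  have L0 : 0 < L := by linarith
  have : 0 ≤ L ^ (r + 2) * S := by positivity
  calc T ≤ _ := h4
    _ ≤ (2 * (r + 2)) ^ (r + 2) * TV + (2 * (r + 2)) ^ (r + 2) * (L ^ (r + 2) * S) := by gcongr
    _ = _ := by ring

end
end MRec

namespace MRec
section
variable {n : ℕ} {R C : Type*}

noncomputable def ML (B : Finset (Fin n) → Matrix R C ℝ) (y : Fin n → ℝ) : Matrix R C ℝ :=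
  ∑ S : Finset (Fin n), (∏ i ∈ S, y i) • B S

noncomputable def del (i : Fin n) (B : Finset (Fin n) → Matrix R C ℝ) (S : Finset (Fin n)) :
    Matrix R C ℝ := if i ∈ S then 0 else B (insert i S)

lemma sum_key {M : Type*} [AddCommMonoid M] (i : Fin n) (f : Finset (Fin n) → M) :
    ∑ S : Finset (Fin n), (if i ∈ S then 0 else f (insert i S)) =
      ∑ S : Finset (Fin n), (if i ∈ S then f S else 0) := by
  have h := Finset.notMem_erase i (Finset.univ : Finset (Fin n))
  have e : (Finset.univ : Finset (Finset (Fin n))) =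
      (insert i (Finset.univ.erase i)).powerset := by
    rw [Finset.insert_erase (Finset.mem_univ i), Finset.powerset_univ]
  rw [e, Finset.sum_powerset_insert h, Finset.sum_powerset_insert h]
  have h0 : ∀ t ∈ (Finset.univ.erase i : Finset (Fin n)).powerset, i ∉ t := fun t ht hi =>
    h (Finset.mem_powerset.1 ht hi)
  have z1 : ∑ t ∈ (Finset.univ.erase i : Finset (Fin n)).powerset,
      (if i ∈ insert i t then (0 : M) else f (insert i (insert i t))) = 0 :=
    Finset.sum_eq_zero fun t _ => by simp
  have z2 : ∑ t ∈ (Finset.univ.erase i : Finset (Fin n)).powerset,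
      (if i ∈ t then f t else 0) = 0 :=
    Finset.sum_eq_zero fun t ht => by simp [h0 t ht]
  rw [z1, z2, add_zero, zero_add]
  refine Finset.sum_congr rfl fun t ht => by simp [h0 t ht]

lemma smul_ML_del (B : Finset (Fin n) → Matrix R C ℝ) (i : Fin n) (y : Fin n → ℝ) :
    y i • ML (del i B) y = ∑ S : Finset (Fin n), if i ∈ S then (∏ j ∈ S, y j) • B S else 0 := by
  rw [← sum_key i (fun S => (∏ j ∈ S, y j) • B S), ML, Finset.smul_sum]
  refine Finset.sum_congr rfl fun S _ => ?_
  by_cases h : i ∈ S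
  · simp [h, del]
  · simp [h, del, Finset.prod_insert h, smul_smul]

lemma prod_update (i : Fin n) (y : Fin n → ℝ) (S : Finset (Fin n)) :
    ∏ j ∈ S, Function.update y i 0 j = if i ∈ S then 0 else ∏ j ∈ S, y j := by
  split_ifs with h
  · exact Finset.prod_eq_zero h (by simp)
  · refine Finset.prod_congr rfl fun j hj => ?_
    rw [Function.update_of_ne]; rintro rfl; exact h hj

lemma ML_sub (B : Finset (Fin n) → Matrix R C ℝ) (i : Fin n) (y : Fin n → ℝ) :
    ML B y - ML B (Function.update y i 0) = y i • ML (del i B) y := by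
  rw [smul_ML_del, ML, ML, ← Finset.sum_sub_distrib]
  refine Finset.sum_congr rfl fun S _ => ?_
  rw [prod_update]
  split_ifs <;> simp

lemma prod_update_of_notMem (i : Fin n) (y : Fin n → ℝ) (s : ℝ) (S : Finset (Fin n)) (h : i ∉ S) :
    ∏ j ∈ S, Function.update y i s j = ∏ j ∈ S, y j := by
  refine Finset.prod_congr rfl fun j hj => ?_
  rw [Function.update_of_ne]; rintro rfl; exact h hj

lemma ML_del_update (B : Finset (Fin n) → Matrix R C ℝ) (i : Fin n) (y : Fin n → ℝ) (s : ℝ) :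
    ML (del i B) (Function.update y i s) = ML (del i B) y := by
  rw [ML, ML]
  refine Finset.sum_congr rfl fun S _ => ?_
  by_cases h : i ∈ S
  · simp [del, h]
  · rw [prod_update_of_notMem _ _ _ _ h]

def Hom (k : ℕ) (B : Finset (Fin n) → Matrix R C ℝ) : Prop := ∀ S, S.card ≠ k → B S = 0

lemma Hom.del {k : ℕ} {B : Finset (Fin n) → Matrix R C ℝ} (h : Hom (k + 1) B) (i : Fin n) :
    Hom k (del i B) := by
  intro S hS
  rw [MRec.del]
  split_ifs with hi
  · rfl
  · apply h; rw [Finset.card_insert_of_notMem hi]; omega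

lemma ML_euler {k : ℕ} {B : Finset (Fin n) → Matrix R C ℝ} (h : Hom k B) (y : Fin n → ℝ) :
    (k : ℝ) • ML B y = ∑ i, y i • ML (del i B) y := by
  simp_rw [smul_ML_del]
  rw [Finset.sum_comm, ML, Finset.smul_sum]
  refine Finset.sum_congr rfl fun S _ => ?_
  rw [← Finset.sum_filter, Finset.sum_const, ← Nat.cast_smul_eq_nsmul ℝ]
  have hf : Finset.univ.filter (fun i => i ∈ S) = S := by ext; simp
  rw [hf]
  by_cases hS : S.card = k
  · simp [hS]
  · simp [h S hS]

lemma ML_cont (B : Finset (Fin n) → Matrix R C ℝ) : Continuous (ML B) := by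
  unfold ML; fun_prop

lemma ML_apply (B : Finset (Fin n) → Matrix R C ℝ) (y : Fin n → ℝ) (r : R) (c : C) :
    ML B y r c = ∑ S : Finset (Fin n), (∏ i ∈ S, y i) * B S r c := by
  simp [ML, Matrix.sum_apply]

lemma ML_zero (B : Finset (Fin n) → Matrix R C ℝ) : ML B 0 = B ∅ := by
  rw [ML, Finset.sum_eq_single ∅]
  · simp
  · intro S _ hS
    obtain ⟨i, hi⟩ := Finset.nonempty_iff_ne_empty.2 hS
    rw [Finset.prod_eq_zero hi (by simp), zero_smul]
  · simp

lemma pderivAt_ML (B : Finset (Fin n) → Matrix R C ℝ) (i : Fin n) :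
    pderivAt (ML B) i = ML (del i B) := by
  funext y
  ext r c
  simp only [pderivAt, Matrix.of_apply]
  have hd : DifferentiableAt ℝ (fun y => ML B y r c) y := by
    simp only [ML_apply]
    fun_prop
  rw [← hd.lineDeriv_eq_fderiv, lineDeriv]
  have e : (fun s : ℝ => ML B (y + s • Pi.single i 1) r c) =
      fun s => ML B (Function.update y i 0) r c + (y i + s) * ML (del i B) y r c := by
    funext s
    have hu : y + s • Pi.single i (1 : ℝ) = Function.update y i (y i + s) := by
      funext j
      by_cases hj : j = i
      · subst hj; simp
      · simp [hj]
    have h := ML_sub B i (Function.update y i (y i + s))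
    rw [ML_del_update, Function.update_idem] at h
    have h2 := congrFun (congrFun h r) c
    simp only [Matrix.sub_apply, Matrix.smul_apply, Function.update_self, smul_eq_mul] at h2
    rw [hu]; linarith
  rw [e]
  simp

noncomputable def dels (B : Finset (Fin n) → Matrix R C ℝ) :
    {k : ℕ} → (Fin k → Fin n) → Finset (Fin n) → Matrix R C ℝ
  | 0, _ => B
  | _ + 1, w => del (w (Fin.last _)) (dels B fun j => w j.castSucc)

lemma iterPDeriv_ML (B : Finset (Fin n) → Matrix R C ℝ) {k : ℕ} (w : Fin k → Fin n) :
    iterPDeriv (ML B) w = ML (dels B w) := by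
  induction k with
  | zero => rfl
  | succ k ih => rw [iterPDeriv, dels, ih, pderivAt_ML]

noncomputable def full (B : Finset (Fin n) → Matrix R C ℝ) (s : Multiset (Fin n)) : Matrix R C ℝ :=
  if s.Nodup then B s.toFinset else 0

lemma full_del (B : Finset (Fin n) → Matrix R C ℝ) (i : Fin n) (s : Multiset (Fin n)) :
    full (del i B) s = full B (i ::ₘ s) := by
  simp only [full, del, Multiset.mem_toFinset, Multiset.nodup_cons, Multiset.toFinset_cons]
  by_cases h : i ∈ s <;> by_cases h2 : s.Nodup <;> simp [h, h2]

lemma full_dels (B : Finset (Fin n) → Matrix R C ℝ) {k : ℕ} (w : Fin k → Fin n)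
    (s : Multiset (Fin n)) :
    full (dels B w) s = full B ((List.ofFn w : Multiset (Fin n)) + s) := by
  induction k generalizing s with
  | zero => simp [dels]
  | succ k ih =>
    rw [dels, full_del, ih, List.ofFn_succ']
    congr 1
    simp [List.concat_eq_append, ← Multiset.coe_add, ← Multiset.singleton_add, add_assoc]

noncomputable def blk (B : Finset (Fin n) → Matrix R C ℝ) (a b c : ℕ) :
      Matrix ((Fin a → Fin n) × (Fin c → Fin n) × R) ((Fin b → Fin n) × (Fin c → Fin n) × C) ℝ :=
  Matrix.of fun p q => if p.2.1 = q.2.1 then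
    full B ((List.ofFn p.1 : Multiset (Fin n)) + (List.ofFn q.1 : Multiset (Fin n)) +
      (List.ofFn p.2.1 : Multiset (Fin n))) p.2.2 q.2.2 else 0

lemma derivBlocks_ML (B : Finset (Fin n) → Matrix R C ℝ) (a b c : ℕ) :
    derivBlocks (ML B) a b c 0 = blk B a b c := by
  ext p q
  simp only [derivBlocks, blk, Matrix.of_apply, iterPDeriv_ML, ML_zero]
  have : ∀ {k : ℕ} (w : Fin k → Fin n), dels B w ∅ = full B (List.ofFn w : Multiset (Fin n)) := by
    intro k w
    have := full_dels B w 0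
    simpa [full] using this
  rw [this, List.ofFn_fin_append, List.ofFn_fin_append, ← Multiset.coe_add, ← Multiset.coe_add]

end
end MRec

namespace MRec
section
variable {R C R' C' : Type*} [Fintype R] [Fintype C] [DecidableEq R] [DecidableEq C]
  [Fintype R'] [Fintype C'] [DecidableEq R'] [DecidableEq C']

lemma sP_submatrix (t : ℝ) (M : Matrix R C ℝ) (e : R' ≃ R) (f : C' ≃ C) :
    schattenPow t (M.submatrix e f) = schattenPow t M := by
  rw [schattenPow_eq_spec, schattenPow_eq_spec, transpose_submatrix, submatrix_mul_equiv,
    spec_submatrix]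

lemma sP_transpose (t : ℝ) (ht : 0 < t) (M : Matrix R C ℝ) :
    schattenPow t Mᵀ = schattenPow t M := by
  rw [schattenPow_eq_spec, schattenPow_eq_spec, transpose_transpose,
    spec_mul_comm _ (by simp [Real.zero_rpow ht.ne'])]

lemma sP_nonneg (t : ℝ) (M : Matrix R C ℝ) : 0 ≤ schattenPow t M := by
  refine Finset.sum_nonneg fun i _ => Real.rpow_nonneg ?_ _
  exact (posSemidef_conjTranspose_mul_self M).eigenvalues_nonneg i

lemma spec_ab_gram (t : ℝ) (M : Matrix R C ℝ) :
    spec (ab t) (Mᵀ * M) = schattenPow t M := by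
  obtain ⟨U, a, h1, h2, h3, -⟩ := fn_data (Mᵀ * M) (by simp)
  rw [schattenPow_eq_spec, h3, spec_diag _ _ _ h1, spec_diag _ _ _ h1]
  refine Finset.sum_congr rfl fun i _ => ?_
  have : a i = ((M * U)ᵀ * (M * U)) i i := by
    have : (M * U)ᵀ * (M * U) = Uᵀ * (Mᵀ * M) * U := by
      simp only [transpose_mul, Matrix.mul_assoc]
    rw [this, h3]
    have : Uᵀ * (U * diagonal a * Uᵀ) * U = (Uᵀ * U) * diagonal a * (Uᵀ * U) := by
      simp only [Matrix.mul_assoc]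
    rw [this, h1]; simp
  have : 0 ≤ a i := by
    rw [this, Matrix.mul_apply]
    exact Finset.sum_nonneg fun j _ => mul_self_nonneg _
  rw [ab, abs_of_nonneg this]

lemma spec_ab_sq (p : ℝ) (H : Matrix C C ℝ) (hH : Hᵀ = H) :
    spec (ab p) H = spec (ab (p / 2)) (H * H) := by
  obtain ⟨U, a, h1, h2, h3, -⟩ := fn_data H hH
  have h4 : H * H = U * diagonal (fun i => a i * a i) * Uᵀ := by
    rw [h3]
    have : U * diagonal a * Uᵀ * (U * diagonal a * Uᵀ) = U * diagonal a * (Uᵀ * U) * diagonal a * Uᵀ := by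
      simp only [Matrix.mul_assoc]
    rw [this, h1, Matrix.mul_one, Matrix.mul_assoc U, diagonal_mul_diagonal]
  rw [h4, spec_diag _ _ _ h1]
  conv_lhs => rw [h3, spec_diag _ _ _ h1]
  refine Finset.sum_congr rfl fun i _ => ?_
  rw [ab, ab, abs_mul_self, ← abs_mul_abs_self, ← sq, ← Real.rpow_natCast, ← Real.rpow_mul (abs_nonneg _)]
  congr 1; push_cast; ring

def dil (M : Matrix R C ℝ) : Matrix (R ⊕ C) (R ⊕ C) ℝ := fromBlocks 0 M Mᵀ 0

lemma dil_symm (M : Matrix R C ℝ) : (dil M)ᵀ = dil M := by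
  simp [dil, fromBlocks_transpose]

lemma dil_add (M N : Matrix R C ℝ) : dil (M + N) = dil M + dil N := by
  simp [dil, fromBlocks_add]

lemma dil_sub (M N : Matrix R C ℝ) : dil (M - N) = dil M - dil N := by
  ext (i | i) (j | j) <;> simp [dil]

lemma dil_smul (s : ℝ) (M : Matrix R C ℝ) : dil (s • M) = s • dil M := by
  simp [dil, fromBlocks_smul]

lemma dil_sum {ι : Type*} (s : Finset ι) (M : ι → Matrix R C ℝ) :
    dil (∑ i ∈ s, M i) = ∑ i ∈ s, dil (M i) := by
  classical
  induction s using Finset.induction_on with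
  | empty => ext (i | i) (j | j) <;> simp [dil]
  | insert a s ha ih => rw [Finset.sum_insert ha, Finset.sum_insert ha, dil_add, ih]

lemma dil_cont {X : Type*} [TopologicalSpace X] {f : X → Matrix R C ℝ} (hf : Continuous f) :
    Continuous fun y => dil (f y) := by
  unfold dil
  exact Continuous.matrix_fromBlocks continuous_const hf hf.matrix_transpose continuous_const

lemma dil_sq (M : Matrix R C ℝ) : dil M * dil M = fromBlocks (M * Mᵀ) 0 0 (Mᵀ * M) := by
  simp [dil, fromBlocks_multiply]

lemma trace_dil (p : ℝ) (hp : 0 < p) (M : Matrix R C ℝ) :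
    trace (fn (ab p) (dil M)) = 2 * schattenPow (p / 2) M := by
  rw [trace_fn _ (dil_symm M), spec_ab_sq _ _ (dil_symm M), dil_sq, spec_fromBlocks, spec_ab_gram]
  have := spec_ab_gram (p / 2) Mᵀ
  rw [transpose_transpose] at this
  rw [this, sP_transpose _ (by linarith)]; ring

/-- vertical stacking -/
def vst {ι : Type*} (G : ι → Matrix R C ℝ) : Matrix (ι × R) C ℝ := Matrix.of fun p c => G p.1 p.2 c

/-- horizontal stacking -/
def hst {ι : Type*} (G : ι → Matrix R C ℝ) : Matrix R (ι × C) ℝ := Matrix.of fun r q => G q.1 r q.2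

lemma sum_dil_sq {ι : Type*} [Fintype ι] [DecidableEq ι] (G : ι → Matrix R C ℝ) :
    ∑ i, dil (G i) * dil (G i) = fromBlocks (hst G * (hst G)ᵀ) 0 0 ((vst G)ᵀ * vst G) := by
  simp only [dil_sq]
  ext (i | i) (j | j) <;>
    simp [Matrix.sum_apply, Matrix.mul_apply, hst, vst, Fintype.sum_prod_type]

lemma trace_sum_dil {ι : Type*} [Fintype ι] [DecidableEq ι] (G : ι → Matrix R C ℝ) (q : ℝ) (hq : 0 < q) :
    trace (fn (ab q) (∑ i, dil (G i) * dil (G i))) =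
      schattenPow q (hst G) + schattenPow q (vst G) := by
  have hs : (∑ i, dil (G i) * dil (G i))ᵀ = ∑ i, dil (G i) * dil (G i) := by
    simp only [transpose_sum, transpose_mul, dil_symm]
  rw [trace_fn _ hs, sum_dil_sq, spec_fromBlocks, spec_ab_gram]
  have := spec_ab_gram q (hst G)ᵀ
  rw [transpose_transpose] at this
  rw [this, sP_transpose _ hq]

lemma spec_blockDiagonal {ι : Type*} [Fintype ι] [DecidableEq ι] (φ : ℝ → ℝ) (M : ι → Matrix C C ℝ) :
    spec φ (blockDiagonal M) = ∑ i, spec φ (M i) := by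
  have h : (blockDiagonal M).charpoly = ∏ i, (M i).charpoly := by
    rw [charpoly]
    have : (blockDiagonal M).charmatrix = blockDiagonal fun i => (M i).charmatrix := by
      ext ⟨a, i⟩ ⟨b, j⟩
      by_cases hij : i = j
      · subst hij
        by_cases hab : a = b
        · subst hab; simp [charmatrix_apply, blockDiagonal_apply]
        · simp [charmatrix_apply, blockDiagonal_apply, hab]
      · simp [charmatrix_apply, blockDiagonal_apply, hij]
    rw [this, det_blockDiagonal]; rfl
  rw [spec, h, Polynomial.roots_prod _ _ (Finset.prod_ne_zero_iff.2 fun i _ => (charpoly_monic (M i)).ne_zero)]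
  rw [Multiset.map_bind, Multiset.sum_bind]
  rfl

lemma sP_blockDiagonal {ι : Type*} [Fintype ι] [DecidableEq ι] (t : ℝ) (M : ι → Matrix R C ℝ) :
    schattenPow t (blockDiagonal M) = ∑ i, schattenPow t (M i) := by
  rw [schattenPow_eq_spec, blockDiagonal_transpose, ← blockDiagonal_mul, spec_blockDiagonal]
  exact Finset.sum_congr rfl fun i _ => (schattenPow_eq_spec _ _).symm

variable {n : ℕ}

lemma sP_blk_col (t : ℝ) (B : Finset (Fin n) → Matrix R C ℝ) (a b c : ℕ) :
    schattenPow t (blk (fun S => vst fun i => del i B S) a b c) = schattenPow t (blk B (a + 1) b c) := by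
  let e : (Fin a → Fin n) × (Fin c → Fin n) × (Fin n × R) ≃
      (Fin (a + 1) → Fin n) × (Fin c → Fin n) × R :=
    { toFun := fun p => (Fin.cons p.2.2.1 p.1, p.2.1, p.2.2.2)
      invFun := fun p => (Fin.tail p.1, p.2.1, (p.1 0, p.2.2))
      left_inv := fun p => by simp
      right_inv := fun p => by simp }
  rw [← sP_submatrix t (blk B (a + 1) b c) e (Equiv.refl _)]
  congr 1
  ext ⟨u, w, i, r⟩ ⟨v, w', s⟩
  simp only [blk, submatrix_apply, of_apply, e, Equiv.coe_fn_mk, Equiv.refl_apply]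
  congr 1
  have : ∀ s : Multiset (Fin n), full (fun S => vst fun i => del i B S) s = vst fun i => full (del i B) s := by
    intro s; simp only [full]; split_ifs <;> rfl
  rw [this]
  simp only [vst, of_apply, full_del, List.ofFn_succ, Fin.cons_zero, Fin.cons_succ]
  simp [← Multiset.cons_coe, Multiset.cons_add]

lemma sP_blk_row (t : ℝ) (B : Finset (Fin n) → Matrix R C ℝ) (a b c : ℕ) :
    schattenPow t (blk (fun S => hst fun i => del i B S) a b c) = schattenPow t (blk B a (b + 1) c) := by
  let e : (Fin b → Fin n) × (Fin c → Fin n) × (Fin n × C) ≃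
      (Fin (b + 1) → Fin n) × (Fin c → Fin n) × C :=
    { toFun := fun p => (Fin.cons p.2.2.1 p.1, p.2.1, p.2.2.2)
      invFun := fun p => (Fin.tail p.1, p.2.1, (p.1 0, p.2.2))
      left_inv := fun p => by simp
      right_inv := fun p => by simp }
  rw [← sP_submatrix t (blk B a (b + 1) c) (Equiv.refl _) e]
  congr 1
  ext ⟨u, w, r⟩ ⟨v, w', i, s⟩
  simp only [blk, submatrix_apply, of_apply, e, Equiv.coe_fn_mk, Equiv.refl_apply]
  congr 1
  have : ∀ s : Multiset (Fin n), full (fun S => hst fun i => del i B S) s = hst fun i => full (del i B) s := by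
    intro s; simp only [full]; split_ifs <;> rfl
  rw [this]
  simp only [hst, of_apply, full_del, List.ofFn_succ, Fin.cons_zero, Fin.cons_succ]
  simp only [← Multiset.cons_coe, Multiset.cons_add, Multiset.add_cons]

lemma exE {n : ℕ} (c a : ℕ) (R : Type*) : ∃ e : ((Fin a → Fin n) × (Fin c → Fin n) × R) × Fin n ≃
      (Fin a → Fin n) × (Fin (c + 1) → Fin n) × R, ∀ p, e p =
        (p.1.1, Fin.cons p.2 p.1.2.1, p.1.2.2) :=
    ⟨{ toFun := fun p => (p.1.1, Fin.cons p.2 p.1.2.1, p.1.2.2)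
       invFun := fun p => ((p.1, Fin.tail p.2.1, p.2.2), p.2.1 0)
       left_inv := fun p => by simp
       right_inv := fun p => by simp }, fun p => rfl⟩

lemma sP_blk_diag (t : ℝ) (B : Finset (Fin n) → Matrix R C ℝ) (a b c : ℕ) :
    ∑ i, schattenPow t (blk (del i B) a b c) = schattenPow t (blk B a b (c + 1)) := by
  rw [← sP_blockDiagonal]
  obtain ⟨e, he⟩ := exE (n := n) c a R
  obtain ⟨f, hf⟩ := exE (n := n) c b C
  rw [← sP_submatrix t (blk B a b (c + 1)) e f]
  congr 1
  ext ⟨⟨u, w, r⟩, i⟩ ⟨⟨v, w', s⟩, j⟩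
  simp only [blk, submatrix_apply, of_apply, he, hf, blockDiagonal_apply, Fin.cons_inj, full_del,
    List.ofFn_succ, Fin.cons_zero, Fin.cons_succ]
  simp only [← Multiset.cons_coe, Multiset.add_cons]
  by_cases h1 : i = j <;> by_cases h2 : w = w' <;> simp [h1, h2]

end
end MRec

namespace MRec
section
variable {Ω : Type*} [MeasurableSpace Ω] {μ : Measure Ω} [IsProbabilityMeasure μ]
    {n : ℕ} {x : Fin n → Ω → ℝ} {L : ℝ}

lemma sP_ML_cont {R C : Type*} [Fintype R] [Fintype C] [DecidableEq R] [DecidableEq C]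
    (q : ℝ) (hq : 1 ≤ q) (B : Finset (Fin n) → Matrix R C ℝ) :
    Continuous fun y => schattenPow q (ML B y) := by
  have h := fn_ab_continuous (fun y => dil (ML B y)) (dil_cont (ML_cont B)) (fun y => dil_symm _)
    (2 * q) (by linarith)
  have e : (fun y => schattenPow q (ML B y)) = fun y => 2⁻¹ * trace (fn (ab (2 * q)) (dil (ML B y))) := by
    funext y
    rw [trace_dil _ (by linarith)]
    rw [mul_div_cancel_left₀ q (two_ne_zero)]
    ring
  rw [e]
  fun_prop

lemma ML_hst {R C : Type*} (B : Finset (Fin n) → Matrix R C ℝ) (y : Fin n → ℝ) :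
    hst (fun i => ML (del i B) y) = ML (fun S => hst fun i => del i B S) y := by
  ext r q
  rw [ML_apply]
  simp [hst, ML_apply]

lemma ML_vst {R C : Type*} (B : Finset (Fin n) → Matrix R C ℝ) (y : Fin n → ℝ) :
    vst (fun i => ML (del i B) y) = ML (fun S => vst fun i => del i B S) y := by
  ext r q
  rw [ML_apply]
  simp [vst, ML_apply]

lemma step_ML {R C : Type*} [Fintype R] [Fintype C] [DecidableEq R] [DecidableEq C]
    (hmeas : ∀ i, Measurable (x i)) (hindep : iIndepFun x μ)
    (hmean : ∀ i, ∫ ω, x i ω ∂μ = 0)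
    (hvar : ∀ i, ∫ ω, (x i ω) ^ 2 ∂μ = 1)
    (hbdd : ∀ i, ∀ᵐ ω ∂μ, |x i ω| ≤ L) (hL : 1 ≤ L) (q : ℝ) (hq : 4 ≤ q)
    (k : ℕ) (B : Finset (Fin n) → Matrix R C ℝ) (hB : Hom (k + 1) B) :
    ∫ ω, schattenPow q (ML B fun j => x j ω) ∂μ ≤
      (2 * (2 * q)) ^ (2 * q) *
        (∫ ω, schattenPow q (ML (fun S => vst fun i => del i B S) fun j => x j ω) ∂μ +
         ∫ ω, schattenPow q (ML (fun S => hst fun i => del i B S) fun j => x j ω) ∂μ +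
         L ^ (2 * q) * ∑ i, ∫ ω, schattenPow q (ML (del i B) fun j => x j ω) ∂μ) := by
  have hint := fun Φ hΦ => integrable_cont (μ := μ) hmeas hbdd Φ hΦ
  have h := step_herm hmeas hindep hmean hvar hbdd hL (2 * q - 2) (by linarith)
    (fun y => dil (ML B y)) (fun i y => dil (ML (del i B) y)) (dil_cont (ML_cont B))
    (fun i => dil_cont (ML_cont _)) (fun y => dil_symm _) (fun i y => dil_symm _) k
    (fun y => by
      have := ML_euler hB y
      push_cast at this
      rw [← dil_smul, this, dil_sum]
      simp only [dil_smul])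
    (fun i y => by rw [← dil_sub, ML_sub, dil_smul])
    (fun i y => by rw [ML_del_update])
  simp only [sub_add_cancel, mul_div_cancel_left₀ q (two_ne_zero' ℝ),
    trace_dil (2 * q) (by linarith), trace_sum_dil _ q (by linarith), ML_hst, ML_vst,
    integral_const_mul, ← Finset.mul_sum] at h
  have q1 : 1 ≤ q := by linarith
  rw [integral_add (hint _ (sP_ML_cont q q1 _)) (hint _ (sP_ML_cont q q1 _))] at h
  set a := ∫ ω, schattenPow q (ML (fun S => vst fun i => del i B S) fun j => x j ω) ∂μ with ha
  set b := ∫ ω, schattenPow q (ML (fun S => hst fun i => del i B S) fun j => x j ω) ∂μ with hb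
  set c := ∑ i, ∫ ω, schattenPow q (ML (del i B) fun j => x j ω) ∂μ with hc
  have ha0 : 0 ≤ a := integral_nonneg fun ω => sP_nonneg _ _
  have hb0 : 0 ≤ b := integral_nonneg fun ω => sP_nonneg _ _
  have hK : 0 ≤ (2 * (2 * q)) ^ (2 * q) := by positivity
  have := mul_nonneg hK (add_nonneg ha0 hb0)
  nlinarith

def idx (k : ℕ) : Finset (ℕ × ℕ × ℕ) :=
  (Finset.range (k + 1) ×ˢ Finset.range (k + 1) ×ˢ Finset.range (k + 1)).filter
    fun p => p.1 + p.2.1 + p.2.2 = k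

lemma mem_idx (k : ℕ) (p : ℕ × ℕ × ℕ) : p ∈ idx k ↔ p.1 + p.2.1 + p.2.2 = k := by
  simp [idx]; omega

lemma sum_shift (k : ℕ) (g : ℕ × ℕ × ℕ → ℝ) (hg : ∀ p, 0 ≤ g p) (f : ℕ × ℕ × ℕ → ℕ × ℕ × ℕ)
    (hf : Function.Injective f) (hm : ∀ p ∈ idx k, f p ∈ idx (k + 1)) :
    ∑ p ∈ idx k, g (f p) ≤ ∑ p ∈ idx (k + 1), g p := by
  rw [← Finset.sum_image (f := g) (fun a _ b _ h => hf h)]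
  exact Finset.sum_le_sum_of_subset_of_nonneg (Finset.image_subset_iff.2 hm) fun p _ _ => hg p

lemma exE0 {n : ℕ} (R : Type*) :
    ∃ e : (Fin 0 → Fin n) × (Fin 0 → Fin n) × R ≃ R, ∀ p, e p = p.2.2 :=
  ⟨{ toFun := fun p => p.2.2
     invFun := fun r => (Fin.elim0, Fin.elim0, r)
     left_inv := fun p => by
       refine Prod.ext (Subsingleton.elim _ _) (Prod.ext (Subsingleton.elim _ _) rfl)
     right_inv := fun p => rfl }, fun p => rfl⟩

lemma main_ind (hmeas : ∀ i, Measurable (x i)) (hindep : iIndepFun x μ)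
    (hmean : ∀ i, ∫ ω, x i ω ∂μ = 0)
    (hvar : ∀ i, ∫ ω, (x i ω) ^ 2 ∂μ = 1)
    (hbdd : ∀ i, ∀ᵐ ω ∂μ, |x i ω| ≤ L) (hL : 1 ≤ L) (q : ℝ) (hq : 4 ≤ q) (k : ℕ) :
    ∀ {R C : Type*} [Fintype R] [Fintype C] [DecidableEq R] [DecidableEq C]
    (B : Finset (Fin n) → Matrix R C ℝ) (hB : Hom k B),
    ∫ ω, schattenPow q (ML B fun j => x j ω) ∂μ ≤
      (3 * (2 * (2 * q)) ^ (2 * q)) ^ k *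
        ∑ p ∈ idx k, L ^ (p.2.2 * (2 * q)) * schattenPow q (blk B p.1 p.2.1 p.2.2) := by
  induction k with
  | zero =>
    intro R C _ _ _ _ B hB
    have e : idx 0 = {(0, 0, 0)} := by decide
    have e2 : ∀ y, ML B y = B ∅ := by
      intro y
      rw [ML, Finset.sum_eq_single ∅]
      · simp
      · intro S _ hS
        rw [hB S (by simpa using hS), smul_zero]
      · simp
    obtain ⟨e₁, he₁⟩ := exE0 (n := n) R
    obtain ⟨e₂, he₂⟩ := exE0 (n := n) C
    have e4 : blk B 0 0 0 = (B ∅).submatrix e₁ e₂ := by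
      ext p s
      have : p.2.1 = s.2.1 := Subsingleton.elim _ _
      simp [blk, this, he₁, he₂, full]
    simp only [e2, integral_const, e, Finset.sum_singleton]
    rw [e4, sP_submatrix]
    simp
  | succ k ih =>
    intro R C _ _ _ _ B hB
    refine (step_ML hmeas hindep hmean hvar hbdd hL q hq k B hB).trans ?_
    set K := (2 * (2 * q)) ^ (2 * q) with hK
    have K0 : 0 ≤ K := by positivity
    have L0 : 0 < L := by linarith
    let g : ℕ × ℕ × ℕ → ℝ := fun p => L ^ (p.2.2 * (2 * q)) * schattenPow q (blk B p.1 p.2.1 p.2.2)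
    have hg : ∀ p, 0 ≤ g p := fun p => mul_nonneg (by positivity) (sP_nonneg _ _)
    have h1 := ih (fun S => vst fun i => del i B S) (fun S hS => by
      ext a b; simp [vst, hB.del a.1 S hS])
    have h2 := ih (fun S => hst fun i => del i B S) (fun S hS => by
      ext a b; simp [hst, hB.del b.1 S hS])
    have h3 := Finset.sum_le_sum (s := Finset.univ) fun i _ => ih (del i B) (hB.del i)
    simp only [sP_blk_col] at h1
    simp only [sP_blk_row] at h2
    rw [← Finset.mul_sum, Finset.sum_comm] at h3
    simp only [← Finset.mul_sum, sP_blk_diag] at h3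
    have s1 := sum_shift k g hg (fun p => (p.1 + 1, p.2.1, p.2.2))
      (fun a b h => by simpa [Prod.ext_iff] using h) (fun p hp => by
        rw [mem_idx] at *; simp; omega)
    have s2 := sum_shift k g hg (fun p => (p.1, p.2.1 + 1, p.2.2))
      (fun a b h => by simpa [Prod.ext_iff] using h) (fun p hp => by
        rw [mem_idx] at *; simp; omega)
    have s3 := sum_shift k g hg (fun p => (p.1, p.2.1, p.2.2 + 1))
      (fun a b h => by simpa [Prod.ext_iff] using h) (fun p hp => by
        rw [mem_idx] at *; simp; omega)
    have e3 : ∑ p ∈ idx k, g (p.1, p.2.1, p.2.2 + 1) =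
        L ^ (2 * q) * ∑ p ∈ idx k, L ^ (p.2.2 * (2 * q)) * schattenPow q (blk B p.1 p.2.1 (p.2.2 + 1)) := by
      rw [Finset.mul_sum]
      refine Finset.sum_congr rfl fun p _ => ?_
      simp only [g]
      rw [← mul_assoc (L ^ (2 * q)), ← Real.rpow_add L0]
      congr 2; push_cast; ring
    rw [e3] at s3
    set G := ∑ p ∈ idx (k + 1), g p with hG
    have P0 : 0 ≤ (3 * K) ^ k := by positivity
    have Lq : 0 ≤ L ^ (2 * q) := by positivity
    calc _ ≤ K * ((3 * K) ^ k * G + (3 * K) ^ k * G + (3 * K) ^ k * G) := by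
          refine mul_le_mul_of_nonneg_left ?_ K0
          refine add_le_add (add_le_add ?_ ?_) ?_
          · exact h1.trans (mul_le_mul_of_nonneg_left s1 P0)
          · exact h2.trans (mul_le_mul_of_nonneg_left s2 P0)
          · refine (mul_le_mul_of_nonneg_left h3 Lq).trans ?_
            rw [mul_left_comm]
            exact mul_le_mul_of_nonneg_left s3 P0
      _ = (3 * K) ^ (k + 1) * G := by ring

end
end MRec

namespace MRec
section
variable {Ω : Type*} [MeasurableSpace Ω] {μ : Measure Ω} [IsProbabilityMeasure μ]
    {n : ℕ} {x : Fin n → Ω → ℝ} {L : ℝ}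

noncomputable def Bd {R C : Type*} {d : ℕ} (A : (Fin d → Fin n) → Matrix R C ℝ)
    (S : Finset (Fin n)) : Matrix R C ℝ :=
  ∑ j ∈ Finset.univ.filter (fun j : Fin d → Fin n => Function.Injective j),
    if Finset.univ.image j = S then A j else 0

lemma ML_Bd {R C : Type*} {d : ℕ} (A : (Fin d → Fin n) → Matrix R C ℝ) (y : Fin n → ℝ) :
    ML (Bd A) y = ∑ j ∈ Finset.univ.filter (fun j : Fin d → Fin n => Function.Injective j),
      (∏ m, y (j m)) • A j := by
  simp only [ML, Bd, Finset.smul_sum]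
  rw [Finset.sum_comm]
  refine Finset.sum_congr rfl fun j hj => ?_
  have hj' : Function.Injective j := (Finset.mem_filter.1 hj).2
  simp only [smul_ite, smul_zero]
  rw [Finset.sum_ite_eq, if_pos (Finset.mem_univ _), Finset.prod_image fun a _ b _ h => hj' h]

lemma Hom_Bd {R C : Type*} {d : ℕ} (A : (Fin d → Fin n) → Matrix R C ℝ) : Hom d (Bd A) := by
  intro S hS
  refine Finset.sum_eq_zero fun j hj => ?_
  have hj' : Function.Injective j := (Finset.mem_filter.1 hj).2
  rw [if_neg]
  rintro rfl
  apply hS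
  rw [Finset.card_image_of_injective _ hj']; simp

lemma ML_apply_cont {R C : Type*} (B : Finset (Fin n) → Matrix R C ℝ) (r : R) (c : C) :
    Continuous fun y => ML B y r c := by
  simp only [ML_apply]; fun_prop

lemma mean_zero {R C : Type*} (hmeas : ∀ i, Measurable (x i)) (hindep : iIndepFun x μ)
    (hmean : ∀ i, ∫ ω, x i ω ∂μ = 0)
    (hbdd : ∀ i, ∀ᵐ ω ∂μ, |x i ω| ≤ L) (d : ℕ) (hd : 1 ≤ d)
    (B : Finset (Fin n) → Matrix R C ℝ) (hB : Hom d B) (r : R) (c : C) :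
    ∫ ω, ML B (fun j => x j ω) r c ∂μ = 0 := by
  have h : (d : ℝ) * ∫ ω, ML B (fun j => x j ω) r c ∂μ = 0 := by
    rw [← integral_const_mul]
    have e : ∀ y, (d : ℝ) * ML B y r c = ∑ i, y i ^ 1 * ML (del i B) (Function.update y i 0) r c := by
      intro y
      have := congrFun (congrFun (ML_euler hB y) r) c
      simp only [Matrix.smul_apply, Matrix.sum_apply, smul_eq_mul] at this
      rw [this]
      simp only [pow_one, ML_del_update]
    simp only [e]
    rw [integral_finsetSum]
    · refine Finset.sum_eq_zero fun i _ => ?_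
      rw [integral_indep hmeas hindep i 1 (fun y => ML (del i B) y r c) (ML_apply_cont _ _ _)]
      simp [hmean]
    · intro i _
      have c1 := (ML_apply_cont (del i B) r c).comp (upd_cont i)
      exact integrable_cont hmeas hbdd (fun y => y i ^ 1 * ML (del i B) (Function.update y i 0) r c)
        (((continuous_apply i).pow 1).mul c1)
  have hd' : (d : ℝ) ≠ 0 := by positivity
  exact (mul_eq_zero.1 h).resolve_left hd'

lemma sP_sum {R C : Type*} [Fintype R] [Fintype C] [DecidableEq R] [DecidableEq C]
    {ι : Type*} (s : Finset ι) (hs : s.Nonempty) (M : ι → Matrix R C ℝ) (q : ℝ) (hq : 4 ≤ q) :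
    schattenPow q (∑ i ∈ s, M i) ≤ (2 * s.card) ^ (2 * q) * ∑ i ∈ s, schattenPow q (M i) := by
  have h := trace_sum_ab s hs (fun i => dil (M i)) (fun i => dil_symm _) (2 * q - 2) (by linarith)
  simp only [← dil_sum, sub_add_cancel, trace_dil (2 * q) (by linarith), ← Finset.mul_sum,
    mul_div_cancel_left₀ q (two_ne_zero' ℝ)] at h
  nlinarith

lemma const_le (t : ℝ) (ht : 2 ≤ t) (D d : ℕ) (hd : 1 ≤ d) :
    (2 * (D : ℝ)) ^ (2 * (2 * t)) * (3 * (2 * (2 * (2 * t))) ^ (2 * (2 * t))) ^ d ≤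
      (D : ℝ) ^ (4 * t) * (48 * d * t) ^ (4 * d * t) := by
  have hd' : (1 : ℝ) ≤ d := by exact_mod_cast hd
  have e4 : 2 * (2 * t) = 4 * t := by ring
  rw [e4, Real.mul_rpow (by norm_num) (Nat.cast_nonneg D), mul_comm ((2 : ℝ) ^ (4 * t)), mul_assoc]
  refine mul_le_mul_of_nonneg_left ?_ (by positivity)
  have h1 : (2 : ℝ) ^ (4 * t) ≤ 2 ^ (4 * t * d) :=
    Real.rpow_le_rpow_of_exponent_le (by norm_num) (by nlinarith)
  have h2 : (3 : ℝ) ≤ 3 ^ (4 * t) := by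
    calc (3 : ℝ) = 3 ^ (1 : ℝ) := by simp
      _ ≤ _ := Real.rpow_le_rpow_of_exponent_le (by norm_num) (by linarith)
  have h3 : (3 * (2 * (4 * t)) ^ (4 * t)) ^ d ≤ (24 * t) ^ (4 * t * d) := by
    calc (3 * (2 * (4 * t)) ^ (4 * t)) ^ d ≤ (3 ^ (4 * t) * (2 * (4 * t)) ^ (4 * t)) ^ d := by
          gcongr
      _ = (24 * t) ^ (4 * t * d) := by
          rw [← Real.mul_rpow (by norm_num) (by positivity), ← Real.rpow_natCast, ← Real.rpow_mul (by positivity)]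
          congr 1; ring
  calc (2 : ℝ) ^ (4 * t) * (3 * (2 * (4 * t)) ^ (4 * t)) ^ d ≤ 2 ^ (4 * t * d) * (24 * t) ^ (4 * t * d) := by
        gcongr
    _ = (48 * t) ^ (4 * t * d) := by
        rw [← Real.mul_rpow (by norm_num) (by positivity)]; congr 1; ring
    _ ≤ (48 * d * t) ^ (4 * t * d) := by
        refine Real.rpow_le_rpow (by positivity) (by nlinarith) (by positivity)
    _ = _ := by congr 1; ring

lemma core {R C : Type*} [Fintype R] [Fintype C] [DecidableEq R] [DecidableEq C]
    (hmeas : ∀ i, Measurable (x i)) (hindep : iIndepFun x μ)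
    (hmean : ∀ i, ∫ ω, x i ω ∂μ = 0)
    (hvar : ∀ i, ∫ ω, (x i ω) ^ 2 ∂μ = 1)
    (hbdd : ∀ i, ∀ᵐ ω ∂μ, |x i ω| ≤ L) (hL : 1 ≤ L) (D : ℕ)
    (B : ℕ → Finset (Fin n) → Matrix R C ℝ) (hB : ∀ d, Hom d (B d)) (t : ℝ) (ht : 2 ≤ t) :
    ∫ ω, schattenPow (2 * t) (∑ d ∈ Finset.Icc 1 D, ML (B d) fun i => x i ω) ∂μ ≤
      ∑ d ∈ Finset.Icc 1 D, (D : ℝ) ^ (4 * t) * (48 * d * t) ^ (4 * d * t) *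
        ∑ p ∈ idx d, L ^ (p.2.2 * (2 * (2 * t))) * schattenPow (2 * t) (blk (B d) p.1 p.2.1 p.2.2) := by
  have L0 : 0 < L := by linarith
  rcases Nat.eq_zero_or_pos D with rfl | hD
  · simp only [Finset.Icc_eq_empty_of_lt zero_lt_one, Finset.sum_empty]
    have : schattenPow (2 * t) (0 : Matrix R C ℝ) = 0 := by
      have h : ∀ φ : ℝ → ℝ, φ 0 = 0 → spec φ (0 : Matrix C C ℝ) = 0 := by
        intro φ hφ
        have := spec_diag φ (1 : Matrix C C ℝ) (fun _ => 0) (by simp)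
        simpa [hφ] using this
      rw [schattenPow_eq_spec]
      simpa using h (fun x => x ^ (2 * t)) (Real.zero_rpow (by linarith))
    simp [this]
  have hne : (Finset.Icc 1 D).Nonempty := ⟨1, by simp; omega⟩
  have hint := fun d => integrable_cont (μ := μ) hmeas hbdd _ (sP_ML_cont (2 * t) (by linarith) (B d))
  have h1 : ∫ ω, schattenPow (2 * t) (∑ d ∈ Finset.Icc 1 D, ML (B d) fun i => x i ω) ∂μ ≤
      ∫ ω, (2 * (D : ℝ)) ^ (2 * (2 * t)) * ∑ d ∈ Finset.Icc 1 D,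
        schattenPow (2 * t) (ML (B d) fun i => x i ω) ∂μ := by
    refine integral_mono_of_nonneg (Filter.Eventually.of_forall fun ω => sP_nonneg _ _)
      ((integrable_finsetSum _ fun d _ => hint d).const_mul _) (Filter.Eventually.of_forall fun ω => ?_)
    have := sP_sum (Finset.Icc 1 D) hne (fun d => ML (B d) fun i => x i ω) (2 * t) (by linarith)
    simpa using this
  refine h1.trans ?_
  rw [integral_const_mul, integral_finsetSum _ fun d _ => hint d, Finset.mul_sum]
  refine Finset.sum_le_sum fun d hd => ?_
  have h2 := main_ind hmeas hindep hmean hvar hbdd hL (2 * t) (by linarith) d (B d) (hB d)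
  have c := const_le t ht D d (Finset.mem_Icc.1 hd).1
  refine (mul_le_mul_of_nonneg_left h2 (by positivity)).trans ?_
  rw [← mul_assoc]
  refine mul_le_mul_of_nonneg_right c (Finset.sum_nonneg fun p _ => mul_nonneg (by positivity) (sP_nonneg _ _))

lemma L_ge (hbdd : ∀ i, ∀ᵐ ω ∂μ, |x i ω| ≤ L)
    (hvar : ∀ i, ∫ ω, (x i ω) ^ 2 ∂μ = 1) (i : Fin n) : 1 ≤ L := by
  have h : ∫ ω, (x i ω) ^ 2 ∂μ ≤ ∫ ω, L ^ 2 ∂μ := by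
    refine integral_mono_of_nonneg (Filter.Eventually.of_forall fun ω => sq_nonneg _)
      (integrable_const _) ?_
    filter_upwards [hbdd i] with ω hω
    exact sq_le_sq' (abs_le.1 hω).1 (abs_le.1 hω).2
  rw [hvar] at h
  simp at h
  obtain ⟨ω, hω⟩ := (hbdd i).exists
  have := (abs_nonneg _).trans hω
  rwa [abs_of_nonneg this] at h

lemma idx_sum (d : ℕ) (g : ℕ → ℕ → ℕ → ℝ) :
    ∑ a ∈ Finset.range (d + 1), ∑ b ∈ Finset.range (d + 1), ∑ c ∈ Finset.range (d + 1),
      (if a + b + c = d then g a b c else 0) = ∑ p ∈ idx d, g p.1 p.2.1 p.2.2 := by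
  rw [idx, Finset.sum_filter, Finset.sum_product]
  refine Finset.sum_congr rfl fun a _ => ?_
  rw [Finset.sum_product]

end
end MRec

/-- **Multilinear recursion** (Corollary 4.7). Let `x 1, …, x n` be i.i.d. real random
variables with mean `0`, variance `1` and `|x i| ≤ L` a.s. For each `1 ≤ d ≤ D` let
`{A d j}_{j ∈ T^d_n}` be permutation-symmetric deterministic matrices of a common dimension,
let `Fd d` be the degree-`d` homogeneous part `∑_{j ∈ T^d_n} (∏_m x_{j m}) • A d j`, and let
`F = ∑_{d=1}^D Fd d`. Then for every `2 ≤ t < ∞`,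
`E ‖F(x) − E F(x)‖_{4t}^{4t}
  ≤ ∑_{d=1}^D D^{4t} (48dt)^{4dt} ∑_{a+b+c=d} L^{4ct} ‖(F^{=d})_{a,b,c}‖_{4t}^{4t}`. -/
theorem multilinear_recursion
    {Ω : Type*} [MeasurableSpace Ω] (μ : Measure Ω) [IsProbabilityMeasure μ]
    (n D : ℕ) {d₁ d₂ : Type*} [Fintype d₁] [Fintype d₂] [DecidableEq d₁] [DecidableEq d₂]
    (x : Fin n → Ω → ℝ) (L : ℝ)
    (hmeas : ∀ i, Measurable (x i))
    (hindep : iIndepFun x μ)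
    (hid : ∀ i j, IdentDistrib (x i) (x j) μ μ)
    (hmean : ∀ i, ∫ ω, x i ω ∂μ = 0)
    (hvar : ∀ i, ∫ ω, (x i ω) ^ 2 ∂μ = 1)
    (hbdd : ∀ i, ∀ᵐ ω ∂μ, |x i ω| ≤ L)
    (A : (d : ℕ) → (Fin d → Fin n) → Matrix d₁ d₂ ℝ)
    (hsymm : ∀ (d : ℕ) (σ : Equiv.Perm (Fin d)) (j : Fin d → Fin n), A d (j ∘ σ) = A d j)
    (Fd : ℕ → (Fin n → ℝ) → Matrix d₁ d₂ ℝ)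
    (hFd : ∀ d, Fd d = fun v => ∑ j ∈ Finset.univ.filter
        (fun j : Fin d → Fin n => Function.Injective j),
      (∏ m, v (j m)) • A d j)
    (F : (Fin n → ℝ) → Matrix d₁ d₂ ℝ)
    (hF : F = fun v => ∑ d ∈ Finset.Icc 1 D, Fd d v)
    (t : ℝ) (ht : 2 ≤ t) :
    ∫ ω, schattenPow (2 * t)
        ((F fun i => x i ω) - matIntegral μ fun ω => F fun i => x i ω) ∂μ
      ≤ ∑ d ∈ Finset.Icc 1 D, (D : ℝ) ^ (4 * t) * (48 * d * t) ^ (4 * d * t) *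
          ∑ a ∈ Finset.range (d + 1), ∑ b ∈ Finset.range (d + 1), ∑ c ∈ Finset.range (d + 1),
            if a + b + c = d then
              L ^ (4 * c * t) * schattenPow (2 * t) (derivBlocks (Fd d) a b c 0)
            else 0 := by
  have hFB : ∀ d, Fd d = MRec.ML (MRec.Bd (A d)) := by
    intro d
    rw [hFd]
    funext y
    rw [MRec.ML_Bd]
  have hFy : ∀ y, F y = ∑ d ∈ Finset.Icc 1 D, MRec.ML (MRec.Bd (A d)) y := by
    intro y; rw [hF]; simp only [hFB]
  have h0 : (matIntegral μ fun ω => F fun i => x i ω) = 0 := by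
    ext r c
    simp only [matIntegral, Matrix.of_apply, hFy, Matrix.sum_apply, Matrix.zero_apply]
    rw [integral_finsetSum]
    · refine Finset.sum_eq_zero fun d hd => ?_
      exact MRec.mean_zero hmeas hindep hmean hbdd d (Finset.mem_Icc.1 hd).1 _ (MRec.Hom_Bd _) r c
    · intro d _
      exact MRec.integrable_cont hmeas hbdd _ (MRec.ML_apply_cont _ r c)
  simp only [h0, sub_zero]
  simp only [hFy, hFB, MRec.derivBlocks_ML, MRec.idx_sum]
  rcases Nat.eq_zero_or_pos n with hn | hn
  · subst hn
    refine (MRec.core (L := 1) hmeas hindep hmean hvar (fun i => i.elim0) le_rfl D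
      (fun d => MRec.Bd (A d)) (fun d => MRec.Hom_Bd _) t ht).trans (le_of_eq ?_)
    refine Finset.sum_congr rfl fun d _ => ?_
    congr 1
    refine Finset.sum_congr rfl fun p _ => ?_
    obtain ⟨a, b, c⟩ := p
    rcases c with _ | c
    · simp
    · have : schattenPow (2 * t) (MRec.blk (MRec.Bd (A d)) a b (c + 1)) = 0 := by
        rw [schattenPow]
        exact Finset.sum_eq_zero fun i _ => (i.2.1 0).elim0
      simp only [this, mul_zero]
  · refine (MRec.core hmeas hindep hmean hvar hbdd (MRec.L_ge hbdd hvar ⟨0, hn⟩) D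
      (fun d => MRec.Bd (A d)) (fun d => MRec.Hom_Bd _) t ht).trans (le_of_eq ?_)
    refine Finset.sum_congr rfl fun d _ => ?_
    congr 1
    refine Finset.sum_congr rfl fun p _ => ?_
    congr 2
    ring
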